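/- arXiv:1501.02708 — 8 statements merged into one kernel-verified Lean document; each statement's English description precedes it below -/
import Mathlib

section
/- Let d ≥ 1 and let C be a controlled unitary on the d × d system (controlled from the A side or from the B side). Then the Schmidt rank of the matrix product SWAP_d · C equals d². -/
open Matrix Kronecker BigOperators

/-- `U` is controlled from the A side in the computational basis. -/
def CtrlAcb {dA dB : ℕ} (U : Matrix (Fin dA × Fin dB) (Fin dA × Fin dB) ℂ) : Prop :=
  ∀ p q : Fin dA × Fin dB, p.1 ≠ q.1 → U p q = 0

/-- `U` is controlled from the B side in the computational basis. -/
def CtrlBcb {dA dB : ℕ} (U : Matrix (Fin dA × Fin dB) (Fin dA × Fin dB) ℂ) : Prop :=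
  ∀ p q : Fin dA × Fin dB, p.2 ≠ q.2 → U p q = 0

/-- `U` is a controlled unitary from the A side (up to local unitaries on the A factor). -/
def IsCtrlA {dA dB : ℕ} (U : Matrix (Fin dA × Fin dB) (Fin dA × Fin dB) ℂ) : Prop :=
  ∃ X Y : Matrix (Fin dA) (Fin dA) ℂ,
    X ∈ Matrix.unitaryGroup (Fin dA) ℂ ∧ Y ∈ Matrix.unitaryGroup (Fin dA) ℂ ∧
    CtrlAcb ((X ⊗ₖ (1 : Matrix (Fin dB) (Fin dB) ℂ)) * U * (Y ⊗ₖ (1 : Matrix (Fin dB) (Fin dB) ℂ)))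

/-- `U` is a controlled unitary from the B side (up to local unitaries on the B factor). -/
def IsCtrlB {dA dB : ℕ} (U : Matrix (Fin dA × Fin dB) (Fin dA × Fin dB) ℂ) : Prop :=
  ∃ X Y : Matrix (Fin dB) (Fin dB) ℂ,
    X ∈ Matrix.unitaryGroup (Fin dB) ℂ ∧ Y ∈ Matrix.unitaryGroup (Fin dB) ℂ ∧
    CtrlBcb (((1 : Matrix (Fin dA) (Fin dA) ℂ) ⊗ₖ X) * U * ((1 : Matrix (Fin dA) (Fin dA) ℂ) ⊗ₖ Y))

/-- `U` is a controlled unitary: a unitary controlled from the A side or from the B side. -/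
def IsCtrlUnitary {dA dB : ℕ} (U : Matrix (Fin dA × Fin dB) (Fin dA × Fin dB) ℂ) : Prop :=
  U ∈ Matrix.unitaryGroup (Fin dA × Fin dB) ℂ ∧ (IsCtrlA U ∨ IsCtrlB U)

/-- The SWAP gate on the `d × d` system. -/
def Swap (d : ℕ) : Matrix (Fin d × Fin d) (Fin d × Fin d) ℂ :=
  fun p q => if p.1 = q.2 ∧ p.2 = q.1 then 1 else 0

/-- The Schmidt rank of a bipartite matrix: the least `n` such that
`M = ∑ j, A j ⊗ₖ B j` for some families of local matrices. -/
noncomputable def schmidtRank {dA dB : ℕ}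
    (M : Matrix (Fin dA × Fin dB) (Fin dA × Fin dB) ℂ) : ℕ :=
  sInf {n : ℕ | ∃ (A : Fin n → Matrix (Fin dA) (Fin dA) ℂ)
    (B : Fin n → Matrix (Fin dB) (Fin dB) ℂ), M = ∑ j, A j ⊗ₖ B j}

/-- The partial transpose of a bipartite matrix with respect to the first factor. -/
def partialTranspose {ι κ R : Type*} (M : Matrix (ι × κ) (ι × κ) R) : Matrix (ι × κ) (ι × κ) R :=
  fun p q => M (q.1, p.2) (p.1, q.2)

theorem partialTranspose_kronecker_mul_mul_kronecker {ι κ R : Type*} [Fintype ι] [Fintype κ]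
    [CommSemiring R] (X Y : Matrix ι ι R) (V W : Matrix κ κ R) (M : Matrix (ι × κ) (ι × κ) R) :
    partialTranspose ((X ⊗ₖ V) * M * (Y ⊗ₖ W)) =
      (Yᵀ ⊗ₖ V) * partialTranspose M * (Xᵀ ⊗ₖ W) := by
  ext ⟨a, b⟩ ⟨a', b'⟩
  simp only [partialTranspose, mul_apply, kroneckerMap_apply, transpose_apply,
    Fintype.sum_prod_type, Finset.sum_mul]
  calc _ = ∑ q₁, ∑ p₁, ∑ q₂, ∑ p₂,
        X a' p₁ * V b p₂ * M (p₁, p₂) (q₁, q₂) * (Y q₁ a * W q₂ b') :=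
        Finset.sum_congr rfl fun _ _ => Finset.sum_comm
    _ = ∑ p₁, ∑ q₁, ∑ q₂, ∑ p₂,
        X a' p₁ * V b p₂ * M (p₁, p₂) (q₁, q₂) * (Y q₁ a * W q₂ b') := Finset.sum_comm
    _ = ∑ p₁, ∑ q₂, ∑ q₁, ∑ p₂,
        X a' p₁ * V b p₂ * M (p₁, p₂) (q₁, q₂) * (Y q₁ a * W q₂ b') :=
        Finset.sum_congr rfl fun _ _ => Finset.sum_comm
    _ = _ := by
      refine Finset.sum_congr rfl fun _ _ => Finset.sum_congr rfl fun _ _ =>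
        Finset.sum_congr rfl fun _ _ => Finset.sum_congr rfl fun _ _ => ?_
      ring

theorem CtrlAcb.partialTranspose_eq {dA dB : ℕ}
    {U : Matrix (Fin dA × Fin dB) (Fin dA × Fin dB) ℂ} (hU : CtrlAcb U) :
    partialTranspose U = U := by
  ext ⟨a, b⟩ ⟨a', b'⟩
  by_cases h : a = a'
  · subst h; rfl
  · exact (hU (a', b) (a, b') (Ne.symm h)).trans (hU (a, b) (a', b') h).symm

theorem CtrlBcb.partialTranspose_eq {dA dB : ℕ}
    {U : Matrix (Fin dA × Fin dB) (Fin dA × Fin dB) ℂ} (hU : CtrlBcb U) :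
    partialTranspose U = Uᵀ := by
  ext ⟨a, b⟩ ⟨a', b'⟩
  by_cases h : b = b'
  · subst h; rfl
  · exact (hU (a', b) (a, b') h).trans (hU (a', b') (a, b) (Ne.symm h)).symm

theorem isUnit_of_mul_mul_isUnit {n R : Type*} [Fintype n] [DecidableEq n] [CommRing R]
    {A B C : Matrix n n R} (h : IsUnit (A * B * C)) : IsUnit B := by
  rw [isUnit_iff_isUnit_det, det_mul, det_mul] at h
  exact (isUnit_iff_isUnit_det B).2 (isUnit_of_mul_isUnit_right (isUnit_of_mul_isUnit_left h))

theorem isUnit_of_mem_unitaryGroup {n : Type*} [Fintype n] [DecidableEq n]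
    {U : Matrix n n ℂ} (hU : U ∈ unitaryGroup n ℂ) : IsUnit U :=
  (Unitary.toUnits ⟨U, hU⟩).isUnit

theorem IsCtrlUnitary.isUnit_partialTranspose {dA dB : ℕ}
    {C : Matrix (Fin dA × Fin dB) (Fin dA × Fin dB) ℂ} (hC : IsCtrlUnitary C) :
    IsUnit (partialTranspose C) := by
  obtain ⟨hU, ⟨X, Y, hX, hY, h⟩ | ⟨X, Y, hX, hY, h⟩⟩ := hC
  · have hD := isUnit_of_mem_unitaryGroup (mul_mem (mul_mem
      (kronecker_mem_unitary hX (one_mem (unitaryGroup (Fin dB) ℂ))) hU)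
      (kronecker_mem_unitary hY (one_mem (unitaryGroup (Fin dB) ℂ))))
    rw [← h.partialTranspose_eq, partialTranspose_kronecker_mul_mul_kronecker] at hD
    exact isUnit_of_mul_mul_isUnit hD
  · have hD := isUnit_of_mem_unitaryGroup (mul_mem (mul_mem
      (kronecker_mem_unitary (one_mem (unitaryGroup (Fin dA) ℂ)) hX) hU)
      (kronecker_mem_unitary (one_mem (unitaryGroup (Fin dA) ℂ)) hY))
    rw [← isUnit_transpose, ← h.partialTranspose_eq,
      partialTranspose_kronecker_mul_mul_kronecker] at hD
    exact isUnit_of_mul_mul_isUnit hD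

theorem swap_mul_apply {d : ℕ} (C : Matrix (Fin d × Fin d) (Fin d × Fin d) ℂ)
    (p q : Fin d × Fin d) : (Swap d * C) p q = C p.swap q := by
  rw [mul_apply, Finset.sum_eq_single p.swap]
  · simp [Swap]
  · intro r _ hr
    have : ¬(p.1 = r.2 ∧ p.2 = r.1) := fun h => hr (Prod.ext h.2.symm h.1.symm)
    simp [Swap, this]
  · simp

/-- Every bipartite matrix is a sum of `dA ^ 2` Kronecker products, one for each matrix unit
of the first factor. -/
theorem exists_eq_sum_kronecker {dA dB : ℕ}
    (M : Matrix (Fin dA × Fin dB) (Fin dA × Fin dB) ℂ) :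
    ∃ (A : Fin (dA ^ 2) → Matrix (Fin dA) (Fin dA) ℂ)
      (B : Fin (dA ^ 2) → Matrix (Fin dB) (Fin dB) ℂ), M = ∑ j, A j ⊗ₖ B j := by
  let e : Fin (dA ^ 2) ≃ Fin dA × Fin dA := (finCongr (sq dA)).trans finProdFinEquiv.symm
  refine ⟨fun j => single (e j).1 (e j).2 1,
    fun j => of fun b b' => M ((e j).1, b) ((e j).2, b'), ?_⟩
  ext ⟨a, b⟩ ⟨a', b'⟩
  rw [Matrix.sum_apply, Finset.sum_eq_single (e.symm (a, a'))]
  · simp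
  · intro j _ hj
    have : ¬((e j).1 = a ∧ (e j).2 = a') := fun h =>
      hj (e.eq_symm_apply.2 (Prod.ext h.1 h.2))
    simp [this]
  · simp

theorem rank_partialTranspose_le_of_swap_mul_eq_sum {d n : ℕ}
    {C : Matrix (Fin d × Fin d) (Fin d × Fin d) ℂ} {A B : Fin n → Matrix (Fin d) (Fin d) ℂ}
    (h : Swap d * C = ∑ j, A j ⊗ₖ B j) : (partialTranspose C).rank ≤ n := by
  have hPQ : partialTranspose C =
      (of fun (p : Fin d × Fin d) j => A j p.2 p.1) *
        (of fun j (q : Fin d × Fin d) => B j q.1 q.2) := by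
    ext ⟨a, b⟩ ⟨a', b'⟩
    have hsum := congrFun (congrFun h (b, a')) (a, b')
    rw [swap_mul_apply, Matrix.sum_apply] at hsum
    exact hsum
  rw [hPQ]
  exact (rank_mul_le_left _ _).trans ((rank_le_card_width _).trans_eq (Fintype.card_fin n))

/-- The product of `SWAP_d` with any controlled unitary has Schmidt rank `d²`. -/
theorem swap_mul_ctrl_schmidtRank (d : ℕ) (hd : 1 ≤ d)
    (C : Matrix (Fin d × Fin d) (Fin d × Fin d) ℂ) (hC : IsCtrlUnitary C) :
    schmidtRank (Swap d * C) = d ^ 2 := by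
  have hrank : (partialTranspose C).rank = d ^ 2 := by
    rw [rank_of_isUnit _ hC.isUnit_partialTranspose, Fintype.card_prod, Fintype.card_fin, sq]
  have hmem := exists_eq_sum_kronecker (Swap d * C)
  refine le_antisymm (Nat.sInf_le hmem) (le_csInf ⟨_, hmem⟩ ?_)
  rintro n ⟨A, B, hAB⟩
  exact hrank.symm.trans_le (rank_partialTranspose_le_of_swap_mul_eq_sum hAB)
end

section
/- For every d ≥ 1, the gate SWAP_d is the product of three controlled unitaries on the d × d system; moreover, for d ≥ 2, SWAP_d is not a controlled unitary and is not the product of two controlled unitaries. -/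
open Matrix Kronecker BigOperators

theorem swap_eq_permMatrix (d : ℕ) :
    Swap d = Equiv.Perm.permMatrix ℂ (Equiv.prodComm (Fin d) (Fin d)) := by
  ext ⟨a, b⟩ ⟨c, e⟩
  simp only [Swap, PEquiv.toMatrix_apply, Equiv.toPEquiv_apply, Option.mem_some_iff,
    Equiv.prodComm_apply, Prod.swap_prod_mk, Prod.mk.injEq]
  congr 1
  exact propext and_comm

theorem permMatrix_mem_unitaryGroup {n : Type*} [Fintype n] [DecidableEq n]
    (σ : Equiv.Perm n) : Equiv.Perm.permMatrix ℂ σ ∈ Matrix.unitaryGroup n ℂ := by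
  rw [Matrix.mem_unitaryGroup_iff, star_eq_conjTranspose, conjTranspose_permMatrix,
    ← permMatrix_mul, inv_mul_cancel, permMatrix_one]

theorem isCtrlUnitary_permMatrix_of_fst {dA dB : ℕ} (σ : Equiv.Perm (Fin dA × Fin dB))
    (h : ∀ p, (σ p).1 = p.1) : IsCtrlUnitary (Equiv.Perm.permMatrix ℂ σ) := by
  refine ⟨permMatrix_mem_unitaryGroup σ, Or.inl ⟨1, 1, one_mem _, one_mem _, ?_⟩⟩
  intro p q hpq
  rw [one_kronecker_one, one_mul, mul_one]
  refine (PEquiv.toMatrix_apply _ _ _).trans (if_neg ?_)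
  rw [Equiv.toPEquiv_apply, Option.mem_some_iff]
  rintro rfl
  exact hpq (h p).symm

theorem isCtrlUnitary_permMatrix_of_snd {dA dB : ℕ} (σ : Equiv.Perm (Fin dA × Fin dB))
    (h : ∀ p, (σ p).2 = p.2) : IsCtrlUnitary (Equiv.Perm.permMatrix ℂ σ) := by
  refine ⟨permMatrix_mem_unitaryGroup σ, Or.inr ⟨1, 1, one_mem _, one_mem _, ?_⟩⟩
  intro p q hpq
  rw [one_kronecker_one, one_mul, mul_one]
  refine (PEquiv.toMatrix_apply _ _ _).trans (if_neg ?_)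
  rw [Equiv.toPEquiv_apply, Option.mem_some_iff]
  rintro rfl
  exact hpq (h p).symm

/-- The permutation `(x, y) ↦ (x, x + y)`. -/
def addFstToSnd (G : Type*) [AddCommGroup G] : Equiv.Perm (G × G) where
  toFun p := (p.1, p.1 + p.2)
  invFun p := (p.1, p.2 - p.1)
  left_inv p := by simp
  right_inv p := by simp

/-- The permutation `(x, y) ↦ (y - x, y)`. -/
def subFstFromSnd (G : Type*) [AddCommGroup G] : Equiv.Perm (G × G) where
  toFun p := (p.2 - p.1, p.2)
  invFun p := (p.2 - p.1, p.2)
  left_inv p := by simp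
  right_inv p := by simp

theorem prodComm_eq_mul (G : Type*) [AddCommGroup G] :
    (Equiv.prodComm G G : Equiv.Perm (G × G)) =
      (addFstToSnd G)⁻¹ * (subFstFromSnd G * addFstToSnd G) := by
  rw [eq_inv_mul_iff_mul_eq]
  ext p <;> simp [addFstToSnd, subFstFromSnd, add_comm]

theorem exists_swap_eq_mul_three (d : ℕ) (hd : 1 ≤ d) :
    ∃ U₁ U₂ U₃ : Matrix (Fin d × Fin d) (Fin d × Fin d) ℂ,
      IsCtrlUnitary U₁ ∧ IsCtrlUnitary U₂ ∧ IsCtrlUnitary U₃ ∧ Swap d = U₁ * U₂ * U₃ := by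
  have : NeZero d := ⟨by omega⟩
  refine ⟨Equiv.Perm.permMatrix ℂ (addFstToSnd (Fin d)),
    Equiv.Perm.permMatrix ℂ (subFstFromSnd (Fin d)),
    Equiv.Perm.permMatrix ℂ (addFstToSnd (Fin d))⁻¹,
    isCtrlUnitary_permMatrix_of_fst _ fun _ => rfl,
    isCtrlUnitary_permMatrix_of_snd _ fun _ => rfl,
    isCtrlUnitary_permMatrix_of_fst _ fun _ => rfl, ?_⟩
  rw [← permMatrix_mul, ← permMatrix_mul, swap_eq_permMatrix, prodComm_eq_mul]

theorem swapGate_mul_self (d : ℕ) : Swap d * Swap d = 1 := by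
  rw [swap_eq_permMatrix, ← permMatrix_mul]
  have : (Equiv.prodComm (Fin d) (Fin d) : Equiv.Perm (Fin d × Fin d)) *
      Equiv.prodComm (Fin d) (Fin d) = 1 := by
    ext p <;> simp
  rw [this, permMatrix_one]

theorem swap_mem_unitaryGroup (d : ℕ) : Swap d ∈ Matrix.unitaryGroup (Fin d × Fin d) ℂ :=
  swap_eq_permMatrix d ▸ permMatrix_mem_unitaryGroup _

theorem swap_conj_eq_submatrix {d : ℕ} (U : Matrix (Fin d × Fin d) (Fin d × Fin d) ℂ) :
    Swap d * U * Swap d =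
      U.submatrix (Equiv.prodComm (Fin d) (Fin d)) (Equiv.prodComm (Fin d) (Fin d)) := by
  rw [swap_eq_permMatrix, PEquiv.toMatrix_toPEquiv_mul, PEquiv.mul_toMatrix_toPEquiv]
  rfl

theorem kronecker_submatrix_prodComm {d : ℕ} (X Y : Matrix (Fin d) (Fin d) ℂ) :
    (X ⊗ₖ Y).submatrix (Equiv.prodComm (Fin d) (Fin d)) (Equiv.prodComm (Fin d) (Fin d)) =
      Y ⊗ₖ X := by
  ext p q
  simp [kroneckerMap_apply, mul_comm]

/-- Conjugating by the SWAP gate turns control from the B side into control from the A side. -/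
theorem IsCtrlB.swap_conj {d : ℕ} {U : Matrix (Fin d × Fin d) (Fin d × Fin d) ℂ}
    (h : IsCtrlB U) : IsCtrlA (Swap d * U * Swap d) := by
  obtain ⟨X, Y, hX, hY, hU⟩ := h
  refine ⟨X, Y, hX, hY, fun p q hpq => ?_⟩
  rw [swap_conj_eq_submatrix, ← kronecker_submatrix_prodComm 1 X,
    ← kronecker_submatrix_prodComm 1 Y, submatrix_mul_equiv, submatrix_mul_equiv]
  exact hU _ _ hpq

theorem IsCtrlA.conjTranspose {dA dB : ℕ}
    {U : Matrix (Fin dA × Fin dB) (Fin dA × Fin dB) ℂ} (h : IsCtrlA U) : IsCtrlA Uᴴ := by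
  obtain ⟨X, Y, hX, hY, hU⟩ := h
  refine ⟨Yᴴ, Xᴴ, Unitary.star_mem hY, Unitary.star_mem hX, fun p q hpq => ?_⟩
  have := congrArg star (hU q p (Ne.symm hpq))
  rw [← conjTranspose_apply, star_zero] at this
  simpa only [conjTranspose_mul, conjTranspose_kronecker, conjTranspose_one, mul_assoc] using this

theorem kronecker_one_mem_unitaryGroup {dA : ℕ} (dB : ℕ) {X : Matrix (Fin dA) (Fin dA) ℂ}
    (hX : X ∈ Matrix.unitaryGroup (Fin dA) ℂ) :
    X ⊗ₖ (1 : Matrix (Fin dB) (Fin dB) ℂ) ∈ Matrix.unitaryGroup (Fin dA × Fin dB) ℂ :=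
  kronecker_mem_unitary hX (one_mem _)

/-- The diagonal blocks of a unitary that is controlled from the A side are invertible. -/
theorem CtrlAcb.det_block_ne_zero {dA dB : ℕ}
    {M : Matrix (Fin dA × Fin dB) (Fin dA × Fin dB) ℂ} (h : CtrlAcb M)
    (hM : M ∈ Matrix.unitaryGroup (Fin dA × Fin dB) ℂ) (j : Fin dA) :
    (M.submatrix (Prod.mk j) (Prod.mk j)).det ≠ 0 := by
  have hmul : M.submatrix (Prod.mk j) (Prod.mk j) * (M.submatrix (Prod.mk j) (Prod.mk j))ᴴ
      = 1 := by
    ext k l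
    have h1 := congrFun (congrFun (Matrix.mem_unitaryGroup_iff.mp hM) (j, k)) (j, l)
    rw [mul_apply, Fintype.sum_prod_type, Finset.sum_eq_single j] at h1
    · rw [mul_apply]
      simpa [one_apply, star_apply] using h1
    · intro b _ hb
      exact Finset.sum_eq_zero fun c _ => by rw [h _ _ (by simpa using hb.symm), zero_mul]
    · simp
  intro h0
  have := congrArg det hmul
  simp [h0] at this

/-- The SWAP gate is not the product of two unitaries that are controlled from the A side. -/
theorem swap_ne_mul_of_isCtrlA {d : ℕ} (hd : 2 ≤ d)
    {U V : Matrix (Fin d × Fin d) (Fin d × Fin d) ℂ}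
    (hU : U ∈ Matrix.unitaryGroup (Fin d × Fin d) ℂ)
    (hV : V ∈ Matrix.unitaryGroup (Fin d × Fin d) ℂ)
    (hUA : IsCtrlA U) (hVA : IsCtrlA V) : Swap d ≠ U * V := by
  intro hS
  have : Nontrivial (Fin d) := Fin.nontrivial_iff_two_le.mpr hd
  obtain ⟨X, Y, hX, hY, hM⟩ := hUA
  obtain ⟨X', Y', hX', hY', hN⟩ := hVA
  have hMu := mul_mem (mul_mem (kronecker_one_mem_unitaryGroup d hX) hU)
    (kronecker_one_mem_unitaryGroup d hY)
  have hNu := mul_mem (mul_mem (kronecker_one_mem_unitaryGroup d hX') hV)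
    (kronecker_one_mem_unitaryGroup d hY')
  have hprod : X ⊗ₖ (1 : Matrix (Fin d) (Fin d) ℂ) * U * Y ⊗ₖ 1 * (star Y * star X') ⊗ₖ 1 *
      (X' ⊗ₖ 1 * V * Y' ⊗ₖ 1) = X ⊗ₖ 1 * Swap d * Y' ⊗ₖ 1 := by
    have h1 : Y ⊗ₖ (1 : Matrix (Fin d) (Fin d) ℂ) * (star Y * star X') ⊗ₖ 1 * X' ⊗ₖ 1 = 1 := by
      rw [← mul_kronecker_mul, ← mul_kronecker_mul, ← mul_assoc,
        Matrix.mem_unitaryGroup_iff.mp hY, one_mul, Matrix.mem_unitaryGroup_iff'.mp hX',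
        one_mul, one_mul, one_kronecker_one]
    calc _ = X ⊗ₖ (1 : Matrix (Fin d) (Fin d) ℂ) * U *
          (Y ⊗ₖ (1 : Matrix (Fin d) (Fin d) ℂ) * (star Y * star X') ⊗ₖ 1 * X' ⊗ₖ 1) *
          V * Y' ⊗ₖ 1 := by simp only [mul_assoc]
      _ = _ := by rw [h1, hS]; simp only [mul_assoc, one_mul]
  have hZ : star Y * star X' ∈ Matrix.unitaryGroup (Fin d) ℂ :=
    mul_mem (Unitary.star_mem hY) (Unitary.star_mem hX')
  generalize star Y * star X' = Z at hprod hZ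
  generalize X ⊗ₖ (1 : Matrix (Fin d) (Fin d) ℂ) * U * Y ⊗ₖ 1 = M at *
  generalize X' ⊗ₖ (1 : Matrix (Fin d) (Fin d) ℂ) * V * Y' ⊗ₖ 1 = N at *
  let j : Fin d := ⟨0, by omega⟩
  obtain ⟨i, hi⟩ : ∃ i, Z j i ≠ 0 := by
    by_contra! h
    have := congrFun (congrFun (Matrix.mem_unitaryGroup_iff.mp hZ) j) j
    simp [mul_apply, h] at this
  have key : Z j i • (M.submatrix (Prod.mk j) (Prod.mk j) * N.submatrix (Prod.mk i) (Prod.mk i))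
      = vecMulVec (fun k => Y' k i) (fun l => X j l) := by
    ext k l
    have h2 := congrFun (congrFun hprod (j, k)) (i, l)
    have hR : (X ⊗ₖ (1 : Matrix (Fin d) (Fin d) ℂ) * Swap d *
        Y' ⊗ₖ (1 : Matrix (Fin d) (Fin d) ℂ)) (j, k) (i, l) =
        Y' k i * X j l := by
      simp [mul_apply, Fintype.sum_prod_type, Swap, one_apply, ite_and, mul_comm]
    have hL : (M * Z ⊗ₖ (1 : Matrix (Fin d) (Fin d) ℂ) * N) (j, k) (i, l) =
        ∑ m, M (j, k) (j, m) * Z j i * N (i, m) (i, l) := by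
      rw [mul_apply, Fintype.sum_prod_type, Finset.sum_eq_single i]
      · refine Finset.sum_congr rfl fun m _ => ?_
        rw [mul_apply, Fintype.sum_prod_type, Finset.sum_eq_single j]
        · simp [one_apply]
        · intro b _ hb
          exact Finset.sum_eq_zero fun c _ => by rw [hM _ _ (by simpa using hb.symm), zero_mul]
        · simp
      · intro b _ hb
        exact Finset.sum_eq_zero fun c _ => by rw [hN _ _ (by simpa using hb), mul_zero]
      · simp
    rw [hR, hL] at h2
    rw [vecMulVec_apply, ← h2, Matrix.smul_apply, mul_apply, smul_eq_mul, Finset.mul_sum]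
    refine Finset.sum_congr rfl fun m _ => ?_
    simp only [submatrix_apply]
    ring
  have hdet := congrArg det key
  rw [det_vecMulVec, det_smul, det_mul] at hdet
  exact mul_ne_zero (pow_ne_zero _ hi)
    (mul_ne_zero (hM.det_block_ne_zero hMu j) (hN.det_block_ne_zero hNu i)) hdet

theorem swap_ne_mul_of_isCtrlA_of_isCtrlB {d : ℕ} (hd : 2 ≤ d)
    {U V : Matrix (Fin d × Fin d) (Fin d × Fin d) ℂ}
    (hU : U ∈ Matrix.unitaryGroup (Fin d × Fin d) ℂ)
    (hV : V ∈ Matrix.unitaryGroup (Fin d × Fin d) ℂ)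
    (hUA : IsCtrlA U) (hVB : IsCtrlB V) : Swap d ≠ U * V := by
  intro hS
  have hSu := swap_mem_unitaryGroup d
  have hW : Swap d * V * Swap d ∈ Matrix.unitaryGroup (Fin d × Fin d) ℂ :=
    mul_mem (mul_mem hSu hV) hSu
  refine swap_ne_mul_of_isCtrlA hd (Unitary.star_mem hU) (Unitary.star_mem hW) hUA.conjTranspose
    hVB.swap_conj.conjTranspose ?_
  have h1 : star U * Swap d = V := by
    rw [hS, ← mul_assoc, Matrix.mem_unitaryGroup_iff'.mp hU, one_mul]
  have h2 : Swap d * (Swap d * V * Swap d) = star U := by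
    rw [← mul_assoc, ← mul_assoc, swapGate_mul_self, one_mul, ← h1, mul_assoc, swapGate_mul_self, mul_one]
  rw [← h2, mul_assoc, Matrix.mem_unitaryGroup_iff.mp hW, mul_one]

theorem swap_conj_mul {d : ℕ} {U V : Matrix (Fin d × Fin d) (Fin d × Fin d) ℂ}
    (h : Swap d = U * V) : Swap d = Swap d * U * Swap d * (Swap d * V * Swap d) := by
  calc Swap d = Swap d * (U * V) * Swap d := by rw [← h, swapGate_mul_self, one_mul]
    _ = Swap d * U * (Swap d * Swap d) * V * Swap d := by
      rw [swapGate_mul_self, mul_one]; simp only [mul_assoc]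
    _ = _ := by simp only [mul_assoc]

/-- Conjugating by the SWAP gate turns control from the A side into control from the B side. -/
theorem IsCtrlA.swap_conj {d : ℕ} {U : Matrix (Fin d × Fin d) (Fin d × Fin d) ℂ}
    (h : IsCtrlA U) : IsCtrlB (Swap d * U * Swap d) := by
  obtain ⟨X, Y, hX, hY, hU⟩ := h
  refine ⟨X, Y, hX, hY, fun p q hpq => ?_⟩
  rw [swap_conj_eq_submatrix, ← kronecker_submatrix_prodComm X 1,
    ← kronecker_submatrix_prodComm Y 1, submatrix_mul_equiv, submatrix_mul_equiv]
  exact hU _ _ hpq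

theorem swap_ne_mul_of_isCtrlUnitary {d : ℕ} (hd : 2 ≤ d)
    {U V : Matrix (Fin d × Fin d) (Fin d × Fin d) ℂ}
    (hU : IsCtrlUnitary U) (hV : IsCtrlUnitary V) : Swap d ≠ U * V := by
  have hSu := swap_mem_unitaryGroup d
  obtain ⟨hU, hU' | hU'⟩ := hU <;> obtain ⟨hV, hV' | hV'⟩ := hV
  · exact swap_ne_mul_of_isCtrlA hd hU hV hU' hV'
  · exact swap_ne_mul_of_isCtrlA_of_isCtrlB hd hU hV hU' hV'
  · exact fun h => swap_ne_mul_of_isCtrlA_of_isCtrlB hd (mul_mem (mul_mem hSu hU) hSu)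
      (mul_mem (mul_mem hSu hV) hSu) hU'.swap_conj hV'.swap_conj (swap_conj_mul h)
  · exact fun h => swap_ne_mul_of_isCtrlA hd (mul_mem (mul_mem hSu hU) hSu)
      (mul_mem (mul_mem hSu hV) hSu) hU'.swap_conj hV'.swap_conj (swap_conj_mul h)

theorem isCtrlUnitary_one (dA dB : ℕ) :
    IsCtrlUnitary (1 : Matrix (Fin dA × Fin dB) (Fin dA × Fin dB) ℂ) := by
  rw [← permMatrix_one]
  exact isCtrlUnitary_permMatrix_of_fst 1 fun _ => rfl

/-- `SWAP_d` is the product of three controlled unitaries; for `d ≥ 2` it is neither a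
controlled unitary nor the product of two controlled unitaries. -/
theorem swap_three_ctrl (d : ℕ) (hd : 1 ≤ d) :
    (∃ U₁ U₂ U₃ : Matrix (Fin d × Fin d) (Fin d × Fin d) ℂ,
      IsCtrlUnitary U₁ ∧ IsCtrlUnitary U₂ ∧ IsCtrlUnitary U₃ ∧ Swap d = U₁ * U₂ * U₃) ∧
    (2 ≤ d → ¬ IsCtrlUnitary (Swap d) ∧
      ¬ ∃ U₁ U₂ : Matrix (Fin d × Fin d) (Fin d × Fin d) ℂ,
        IsCtrlUnitary U₁ ∧ IsCtrlUnitary U₂ ∧ Swap d = U₁ * U₂) := by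
  exact ⟨exists_swap_eq_mul_three d hd, fun h2 =>
    ⟨fun h => swap_ne_mul_of_isCtrlUnitary h2 h (isCtrlUnitary_one d d) (mul_one _).symm,
      fun ⟨_, _, h₁, h₂, h⟩ => swap_ne_mul_of_isCtrlUnitary h2 h₁ h₂ h⟩⟩
end

section
/- Every unitary on the 2 × d_B system (d_B ≥ 1) has a 3-sandwich form: U = U_1 U_2 U_3 where U_1 and U_3 are unitaries controlled from the A side in the computational basis and U_2 is a unitary controlled from the B side in the computational basis. -/
open Matrix Kronecker BigOperators

open scoped ComplexOrder in
theorem Matrix.nonneg_of_conjTranspose_mul_self_eq_diagonal {m n : Type*} [Fintype m] [Fintype n]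
    [DecidableEq n] {X : Matrix m n ℂ} {a : n → ℝ}
    (hX : Xᴴ * X = diagonal fun i => (a i : ℂ)) (i : n) : 0 ≤ a i := by
  have h := posSemidef_conjTranspose_mul_self X
  rw [hX, posSemidef_diagonal_iff] at h
  exact Complex.zero_le_real.1 (h i)

/-- A square matrix whose columns are pairwise orthogonal, with squared norms `a i`, is a unitary
times the diagonal matrix of the column norms. -/
theorem Matrix.exists_unitary_mul_diagonal_sqrt {n : Type*} [Fintype n] [DecidableEq n]
    {X : Matrix n n ℂ} {a : n → ℝ} (hX : Xᴴ * X = diagonal fun i => (a i : ℂ)) :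
    ∃ P ∈ unitaryGroup n ℂ, X = P * diagonal fun i => (√(a i) : ℂ) := by
  have ha := nonneg_of_conjTranspose_mul_self_eq_diagonal hX
  let x : n → EuclideanSpace ℂ n := fun i => WithLp.toLp 2 (X.col i)
  have hx (i j : n) : inner ℂ (x i) (x j) = if i = j then (a i : ℂ) else 0 := by
    rw [← diagonal_apply (d := fun i => (a i : ℂ)), ← hX,
      EuclideanSpace.inner_eq_star_dotProduct, dotProduct_comm]
    rfl
  let v : n → EuclideanSpace ℂ n := fun i => ((√(a i) : ℂ))⁻¹ • x i
  have hsq (i : n) : (√(a i) : ℂ) * √(a i) = a i := by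
    exact_mod_cast Real.mul_self_sqrt (ha i)
  have hv : Orthonormal ℂ (({i | a i ≠ 0} : Set n).domRestrict v) := by
    rw [orthonormal_iff_ite]
    rintro ⟨i, hi⟩ ⟨j, hj⟩
    have hi' : (√(a i) : ℂ) ≠ 0 := by
      exact_mod_cast (Real.sqrt_pos.2 (lt_of_le_of_ne (ha i) (Ne.symm hi))).ne'
    simp only [Set.domRestrict_apply, v, inner_smul_left, inner_smul_right, hx, Subtype.mk.injEq]
    split_ifs with h
    · subst h
      rw [← hsq]
      simp [hi']
    · simp
  obtain ⟨b, hb⟩ := hv.exists_orthonormalBasis_extension_of_card_eq (by simp)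
  refine ⟨of fun i j => b j i, ?_, ?_⟩
  · rw [mem_unitaryGroup_iff']
    ext i j
    rw [one_apply, ← orthonormal_iff_ite.1 b.orthonormal i j,
      EuclideanSpace.inner_eq_star_dotProduct, dotProduct_comm]
    rfl
  · ext i j
    rw [mul_diagonal, of_apply]
    by_cases hj : a j = 0
    · have h0 : x j = 0 := by
        rw [← inner_self_eq_zero (𝕜 := ℂ), hx]
        simp [hj]
      simpa [hj, x] using congrArg (fun y : EuclideanSpace ℂ n => y i) h0
    · have hj' : (√(a j) : ℂ) ≠ 0 := by
        exact_mod_cast (Real.sqrt_pos.2 (lt_of_le_of_ne (ha j) (Ne.symm hj))).ne'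
      rw [hb j hj]
      simp only [v, x, PiLp.smul_apply, smul_eq_mul, col_apply]
      field_simp

theorem Matrix.fromBlocks_diagonal_mem_unitaryGroup {m n : Type*} [Fintype m] [DecidableEq m]
    [Fintype n] [DecidableEq n] {P : Matrix m m ℂ} {Q : Matrix n n ℂ}
    (hP : P ∈ unitaryGroup m ℂ) (hQ : Q ∈ unitaryGroup n ℂ) :
    fromBlocks P 0 0 Q ∈ unitaryGroup (m ⊕ n) ℂ := by
  rw [mem_unitaryGroup_iff, star_eq_conjTranspose] at *
  simp [fromBlocks_conjTranspose, fromBlocks_multiply, hP, hQ]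

/-- A block rotation by the angles with cosines `c i` and sines `s i` is unitary. -/
theorem Matrix.fromBlocks_rotation_mem_unitaryGroup {n : Type*} [Fintype n] [DecidableEq n]
    {c s : n → ℝ} (h : ∀ i, c i ^ 2 + s i ^ 2 = 1) :
    fromBlocks (diagonal fun i => (c i : ℂ)) (-diagonal fun i => (s i : ℂ))
      (diagonal fun i => (s i : ℂ)) (diagonal fun i => (c i : ℂ)) ∈ unitaryGroup (n ⊕ n) ℂ := by
  have h' (i : n) : (c i : ℂ) * c i + s i * s i = 1 := by
    have := h i
    rw [← sq, ← sq]
    exact_mod_cast this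
  have h'' (i : n) : (s i : ℂ) * s i + c i * c i = 1 := by rw [add_comm, h']
  rw [mem_unitaryGroup_iff, star_eq_conjTranspose, fromBlocks_conjTranspose, fromBlocks_multiply,
    ← fromBlocks_one]
  congr 1 <;> ext i j <;> by_cases hij : i = j <;>
    simp [diagonal_conjTranspose, one_apply, hij, h', h'', mul_comm]

/-- A unitary block matrix whose first block column is that of the identity is block diagonal. -/
theorem Matrix.exists_eq_fromBlocks_one_of_mem_unitaryGroup {m n : Type*} [Fintype m]
    [DecidableEq m] [Fintype n] [DecidableEq n] {M : Matrix (m ⊕ n) (m ⊕ n) ℂ}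
    (hM : M ∈ unitaryGroup (m ⊕ n) ℂ) (h₁₁ : M.toBlocks₁₁ = 1) (h₂₁ : M.toBlocks₂₁ = 0) :
    ∃ Y ∈ unitaryGroup n ℂ, M = fromBlocks 1 0 0 Y := by
  rw [mem_unitaryGroup_iff', star_eq_conjTranspose, ← fromBlocks_toBlocks M, h₁₁, h₂₁,
    fromBlocks_conjTranspose, fromBlocks_multiply, ← fromBlocks_one, fromBlocks_inj] at hM
  obtain ⟨-, h₁₂, -, h₂₂⟩ := hM
  have hX : M.toBlocks₁₂ = 0 := by simpa using h₁₂
  refine ⟨M.toBlocks₂₂, ?_, ?_⟩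
  · rw [mem_unitaryGroup_iff', star_eq_conjTranspose]
    simpa [hX] using h₂₂
  · conv_lhs => rw [← fromBlocks_toBlocks M, h₁₁, h₂₁, hX]

/-- The cosine-sine decomposition of a unitary with four square blocks. -/
theorem Matrix.exists_cosine_sine_decomposition {n : Type*} [Fintype n] [DecidableEq n]
    {U : Matrix (n ⊕ n) (n ⊕ n) ℂ} (hU : U ∈ unitaryGroup (n ⊕ n) ℂ) :
    ∃ P ∈ unitaryGroup n ℂ, ∃ Q ∈ unitaryGroup n ℂ, ∃ V ∈ unitaryGroup n ℂ,
      ∃ W ∈ unitaryGroup n ℂ, ∃ c s : n → ℝ, (∀ i, c i ^ 2 + s i ^ 2 = 1) ∧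
        U = fromBlocks P 0 0 Q *
          fromBlocks (diagonal fun i => (c i : ℂ)) (-diagonal fun i => (s i : ℂ))
            (diagonal fun i => (s i : ℂ)) (diagonal fun i => (c i : ℂ)) *
          fromBlocks V 0 0 W := by
  obtain ⟨A, B, C, D, rfl⟩ : ∃ A B C D, U = fromBlocks A B C D :=
    ⟨_, _, _, _, (fromBlocks_toBlocks U).symm⟩
  have hAC : Aᴴ * A + Cᴴ * C = 1 := by
    have h := mem_unitaryGroup_iff'.1 hU
    rw [star_eq_conjTranspose, fromBlocks_conjTranspose, fromBlocks_multiply, ← fromBlocks_one,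
      fromBlocks_inj] at h
    exact h.1
  have hH := isHermitian_conjTranspose_mul_self A
  let V : Matrix n n ℂ := hH.eigenvectorUnitary
  have hV : V ∈ unitaryGroup n ℂ := hH.eigenvectorUnitary.2
  have hVV : Vᴴ * V = 1 := mem_unitaryGroup_iff'.1 hV
  let a := hH.eigenvalues
  have hA : (A * V)ᴴ * (A * V) = diagonal fun i => (a i : ℂ) := by
    have h : Aᴴ * A = V * (diagonal fun i => (a i : ℂ)) * Vᴴ := hH.spectral_theorem
    calc (A * V)ᴴ * (A * V) = Vᴴ * (Aᴴ * A) * V := by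
          simp only [conjTranspose_mul, Matrix.mul_assoc]
      _ = (Vᴴ * V) * (diagonal fun i => (a i : ℂ)) * (Vᴴ * V) := by
          rw [h]; simp only [Matrix.mul_assoc]
      _ = _ := by rw [hVV, Matrix.one_mul, Matrix.mul_one]
  have hC : (C * V)ᴴ * (C * V) = diagonal fun i => ((1 - a i : ℝ) : ℂ) := by
    calc (C * V)ᴴ * (C * V) = Vᴴ * (Aᴴ * A + Cᴴ * C) * V - (A * V)ᴴ * (A * V) := by
          simp only [conjTranspose_mul, Matrix.mul_add, Matrix.add_mul, Matrix.mul_assoc]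
          abel
      _ = _ := by
          rw [hAC, hA, Matrix.mul_one, hVV, ← diagonal_one, diagonal_sub]
          simp
  obtain ⟨P, hP, hAP⟩ := exists_unitary_mul_diagonal_sqrt hA
  obtain ⟨Q, hQ, hCQ⟩ := exists_unitary_mul_diagonal_sqrt hC
  have ha := nonneg_of_conjTranspose_mul_self_eq_diagonal hA
  have ha' := nonneg_of_conjTranspose_mul_self_eq_diagonal hC
  have hcs (i : n) : √(a i) ^ 2 + √(1 - a i) ^ 2 = 1 := by
    rw [Real.sq_sqrt (ha i), Real.sq_sqrt (ha' i)]
    ring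
  have hR := fromBlocks_rotation_mem_unitaryGroup hcs
  have hL := fromBlocks_diagonal_mem_unitaryGroup hP hQ
  have hN := fromBlocks_diagonal_mem_unitaryGroup hV (one_mem (unitaryGroup n ℂ))
  have hLR := mul_mem hL hR
  set L := fromBlocks P 0 0 Q
  set R := fromBlocks (diagonal fun i => (√(a i) : ℂ)) (-diagonal fun i => (√(1 - a i) : ℂ))
    (diagonal fun i => (√(1 - a i) : ℂ)) (diagonal fun i => (√(a i) : ℂ))
  set N := fromBlocks V 0 0 (1 : Matrix n n ℂ)
  have hUN : fromBlocks A B C D * N = L * R * fromBlocks 1 0 0 1 +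
      fromBlocks 0 (B - (L * R).toBlocks₁₂) 0 (D - (L * R).toBlocks₂₂) := by
    simp [L, R, N, fromBlocks_multiply, fromBlocks_add, hAP, hCQ]
  have hM : star (L * R) * (fromBlocks A B C D * N) ∈ unitaryGroup (n ⊕ n) ℂ :=
    mul_mem (Unitary.star_mem hLR) (mul_mem hU hN)
  have hLR' := mem_unitaryGroup_iff'.1 hLR
  have hcol : ∃ X Y, star (L * R) * (fromBlocks A B C D * N) = fromBlocks 1 X 0 Y := by
    rw [hUN, fromBlocks_one, Matrix.mul_one, Matrix.mul_add, hLR',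
      ← fromBlocks_toBlocks (star (L * R)), fromBlocks_multiply, ← fromBlocks_one, fromBlocks_add]
    simp
  obtain ⟨X, Y', hXY⟩ := hcol
  obtain ⟨Y, hY, hMY⟩ := exists_eq_fromBlocks_one_of_mem_unitaryGroup hM
    (by rw [hXY, toBlocks_fromBlocks₁₁]) (by rw [hXY, toBlocks_fromBlocks₂₁])
  refine ⟨P, hP, Q, hQ, Vᴴ, Unitary.star_mem hV, Y, hY, fun i => √(a i), fun i => √(1 - a i), hcs, ?_⟩
  have hYV : fromBlocks Vᴴ 0 0 Y = fromBlocks 1 0 0 Y * star N := by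
    simp [N, star_eq_conjTranspose, fromBlocks_conjTranspose, fromBlocks_multiply]
  change _ = L * R * fromBlocks Vᴴ 0 0 Y
  rw [hYV, ← hMY, ← Matrix.mul_assoc, ← Matrix.mul_assoc, mem_unitaryGroup_iff.1 hLR,
    Matrix.one_mul, Matrix.mul_assoc, mem_unitaryGroup_iff.1 hN, Matrix.mul_one]

theorem Matrix.submatrix_equiv_mem_unitaryGroup {m n : Type*} [Fintype m] [DecidableEq m]
    [Fintype n] [DecidableEq n] {U : Matrix m m ℂ} (hU : U ∈ unitaryGroup m ℂ) (e : n ≃ m) :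
    U.submatrix e e ∈ unitaryGroup n ℂ := by
  rw [mem_unitaryGroup_iff, star_eq_conjTranspose] at *
  rw [conjTranspose_submatrix, submatrix_mul_equiv, hU, submatrix_one_equiv]

/-- Every unitary on the `2 × d_B` system has a 3-sandwich form. -/
theorem two_by_d_sandwich (dB : ℕ) (hdB : 1 ≤ dB)
    (U : Matrix (Fin 2 × Fin dB) (Fin 2 × Fin dB) ℂ)
    (hU : U ∈ Matrix.unitaryGroup (Fin 2 × Fin dB) ℂ) :
    ∃ U₁ U₂ U₃ : Matrix (Fin 2 × Fin dB) (Fin 2 × Fin dB) ℂ,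
      U₁ ∈ Matrix.unitaryGroup (Fin 2 × Fin dB) ℂ ∧
      U₂ ∈ Matrix.unitaryGroup (Fin 2 × Fin dB) ℂ ∧
      U₃ ∈ Matrix.unitaryGroup (Fin 2 × Fin dB) ℂ ∧
      CtrlAcb U₁ ∧ CtrlBcb U₂ ∧ CtrlAcb U₃ ∧ U = U₁ * U₂ * U₃ := by
  let e : Fin 2 × Fin dB ≃ Fin dB ⊕ Fin dB :=
    (finTwoEquiv.prodCongr (Equiv.refl _)).trans (Equiv.boolProdEquivSum _)
  have he₀ (k : Fin dB) : e (0, k) = Sum.inl k := rfl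
  have he₁ (k : Fin dB) : e (1, k) = Sum.inr k := rfl
  have hA (P Q : Matrix (Fin dB) (Fin dB) ℂ) : CtrlAcb ((fromBlocks P 0 0 Q).submatrix e e) := by
    rintro ⟨i, k⟩ ⟨j, l⟩ h
    fin_cases i <;> fin_cases j <;> simp_all
  obtain ⟨P, hP, Q, hQ, V, hV, W, hW, c, s, hcs, h⟩ :=
    exists_cosine_sine_decomposition (submatrix_equiv_mem_unitaryGroup hU e.symm)
  refine ⟨_, _, _,
    submatrix_equiv_mem_unitaryGroup (fromBlocks_diagonal_mem_unitaryGroup hP hQ) e,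
    submatrix_equiv_mem_unitaryGroup (fromBlocks_rotation_mem_unitaryGroup hcs) e,
    submatrix_equiv_mem_unitaryGroup (fromBlocks_diagonal_mem_unitaryGroup hV hW) e,
    hA P Q, ?_, hA V W, ?_⟩
  · rintro ⟨i, k⟩ ⟨j, l⟩ h
    fin_cases i <;> fin_cases j <;> simp_all
  · rw [submatrix_mul_equiv, submatrix_mul_equiv, ← h]
    simp
end

section
/- Let d_A ≥ 2 and d_B ≥ 1. Every unitary on the d_A × d_B system has a (2^{⌈log₂ d_A⌉ + 1} − 1)-sandwich form; in particular, every such unitary is the product of at most 4·d_A − 5 unitaries each of which is controlled in the computational basis from the A side or from the B side. -/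
open Matrix Kronecker BigOperators

/-- `U` has an `m`-sandwich form: `U = U₁ U₂ ⋯ U_m` with each `Uᵢ` a unitary controlled in
the computational basis, from the A side for odd `i` and from the B side for even `i`. -/
def HasSandwichForm {dA dB : ℕ} (m : ℕ)
    (U : Matrix (Fin dA × Fin dB) (Fin dA × Fin dB) ℂ) : Prop :=
  ∃ f : Fin m → Matrix (Fin dA × Fin dB) (Fin dA × Fin dB) ℂ,
    (∀ i, f i ∈ Matrix.unitaryGroup (Fin dA × Fin dB) ℂ) ∧
    (∀ i : Fin m, Odd ((i : ℕ) + 1) → CtrlAcb (f i)) ∧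
    (∀ i : Fin m, Even ((i : ℕ) + 1) → CtrlBcb (f i)) ∧
    U = (List.ofFn f).prod

theorem exists_unitary_mul_sqrt {m n : Type*} [Fintype m] [DecidableEq m] [Fintype n]
    [DecidableEq n] (j : n ↪ m) (F : Matrix m n ℂ) (μ : n → ℝ)
    (hF : Fᴴ * F = diagonal (fun k => (μ k : ℂ))) :
    (∀ k, 0 ≤ μ k) ∧ ∃ X ∈ unitaryGroup m ℂ, ∀ i k, F i k = X i (j k) * (√(μ k) : ℝ) := by
  have hin : ∀ k l, inner ℂ (WithLp.toLp 2 (F.col k) : EuclideanSpace ℂ m)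
      (WithLp.toLp 2 (F.col l)) = if k = l then (μ k : ℂ) else 0 := by
    intro k l
    have := congrFun (congrFun hF k) l
    rw [diagonal_apply] at this
    rw [← this, EuclideanSpace.inner_eq_star_dotProduct, dotProduct_comm]
    rfl
  have hnorm : ∀ k, ‖(WithLp.toLp 2 (F.col k) : EuclideanSpace ℂ m)‖ ^ 2 = μ k := by
    intro k
    have := hin k k
    rw [inner_self_eq_norm_sq_to_K, if_pos rfl] at this
    apply Complex.ofReal_injective
    rw [← this]
    simp
  have hμ : ∀ k, 0 ≤ μ k := fun k => hnorm k ▸ sq_nonneg _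
  refine ⟨hμ, ?_⟩
  let v : m → EuclideanSpace ℂ m := Function.extend j
    (fun k => ((√(μ k) : ℝ) : ℂ)⁻¹ • (WithLp.toLp 2 (F.col k) : EuclideanSpace ℂ m)) 0
  have hv : ∀ k, v (j k) = ((√(μ k) : ℝ) : ℂ)⁻¹ • WithLp.toLp 2 (F.col k) :=
    fun k => j.injective.extend_apply _ _ k
  have hon : Orthonormal ℂ ((j '' {k | μ k ≠ 0}).domRestrict v) := by
    classical
    rw [orthonormal_iff_ite]
    rintro ⟨_, k, hk, rfl⟩ ⟨_, l, hl, rfl⟩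
    simp only [Set.domRestrict_apply, hv, inner_smul_left, inner_smul_right, hin]
    by_cases h : k = l
    · subst h
      have h0 : ((√(μ k) : ℝ) : ℂ) ≠ 0 := by
        exact_mod_cast (Real.sqrt_ne_zero (hμ k)).2 hk
      have h1 : (μ k : ℂ) = ((√(μ k) : ℝ) : ℂ) * ((√(μ k) : ℝ) : ℂ) := by
        exact_mod_cast (Real.mul_self_sqrt (hμ k)).symm
      rw [if_pos rfl, if_pos rfl, map_inv₀, Complex.conj_ofReal, h1]
      field_simp
    · rw [if_neg h, mul_zero, mul_zero]
      exact (if_neg (fun e => h (j.injective (congrArg Subtype.val e)))).symm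
  obtain ⟨b, hb⟩ := hon.exists_orthonormalBasis_extension_of_card_eq (by simp)
  refine ⟨of fun i i' => b i' i, ?_, ?_⟩
  · rw [mem_unitaryGroup_iff']
    ext i i'
    rw [Matrix.one_apply, ← orthonormal_iff_ite.1 b.orthonormal i i',
      EuclideanSpace.inner_eq_star_dotProduct, dotProduct_comm]
    rfl
  · intro i k
    by_cases hk : μ k = 0
    · have h0 : (WithLp.toLp 2 (F.col k) : EuclideanSpace ℂ m) = 0 := by
        rw [← norm_eq_zero, ← sq_eq_zero_iff, hnorm, hk]
      have := congrArg (fun w : EuclideanSpace ℂ m => w i) h0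
      simpa [hk] using this
    · have h0 : ((√(μ k) : ℝ) : ℂ) ≠ 0 := by
        exact_mod_cast (Real.sqrt_ne_zero (hμ k)).2 hk
      rw [of_apply, hb _ ⟨k, hk, rfl⟩, hv]
      simp
      field_simp


/-- `M` is block diagonal with respect to the partition of the index set given by `γ`. -/
def BlockDiagWrt {ι κ : Type*} (γ : ι → κ) (M : Matrix ι ι ℂ) : Prop :=
  ∀ x y, γ x ≠ γ y → M x y = 0

theorem blockDiagWrt_one {ι κ : Type*} [DecidableEq ι] (γ : ι → κ) :
    BlockDiagWrt γ (1 : Matrix ι ι ℂ) :=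
  fun _ _ h => one_apply_ne (fun e => h (congrArg γ e))

theorem fromBlocks_mem_unitaryGroup {m n : Type*} [Fintype m] [DecidableEq m] [Fintype n]
    [DecidableEq n] {V : Matrix m m ℂ} {W : Matrix n n ℂ} (hV : V ∈ unitaryGroup m ℂ)
    (hW : W ∈ unitaryGroup n ℂ) : fromBlocks V 0 0 W ∈ unitaryGroup (m ⊕ n) ℂ := by
  rw [mem_unitaryGroup_iff', star_eq_conjTranspose] at *
  simp [fromBlocks_conjTranspose, fromBlocks_multiply, hV, hW]

theorem exists_fromBlocks_of_lastCol {m n : Type*} [Fintype m] [DecidableEq m] [Fintype n]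
    [DecidableEq n] {N : Matrix (m ⊕ n) (m ⊕ n) ℂ} (hN : N ∈ unitaryGroup (m ⊕ n) ℂ)
    (h₁₂ : N.toBlocks₁₂ = 0) (h₂₂ : N.toBlocks₂₂ = 1) :
    ∃ R ∈ unitaryGroup m ℂ, N = fromBlocks R 0 0 1 := by
  have h : N = fromBlocks N.toBlocks₁₁ 0 N.toBlocks₂₁ 1 := by
    rw [← h₁₂, ← h₂₂, fromBlocks_toBlocks]
  rw [mem_unitaryGroup_iff', star_eq_conjTranspose, h, fromBlocks_conjTranspose,
    fromBlocks_multiply, ← fromBlocks_one, fromBlocks_inj] at hN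
  obtain ⟨h1, -, h3, -⟩ := hN
  have h21 : N.toBlocks₂₁ = 0 := by simpa using h3
  refine ⟨N.toBlocks₁₁, ?_, by rw [← h21]; exact h21 ▸ h⟩
  rw [mem_unitaryGroup_iff', star_eq_conjTranspose]
  simpa [h21] using h1

/-- The direct sum of the rotations `!![c, s; -s, c]` in the planes spanned by `j k` and `k`. -/
noncomputable def planeRotations {m n : Type*} [DecidableEq m] [DecidableEq n] (j : n ↪ m) (c s : n → ℝ) :
    Matrix (m ⊕ n) (m ⊕ n) ℂ :=
  fromBlocks (diagonal (Function.extend j (fun k => (c k : ℂ)) 1))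
    (of fun i k => if i = j k then (s k : ℂ) else 0)
    (of fun k i => if i = j k then -(s k : ℂ) else 0)
    (diagonal fun k => (c k : ℂ))

theorem planeRotations_mem_unitaryGroup {m n : Type*} [Fintype m] [DecidableEq m] [Fintype n]
    [DecidableEq n] (j : n ↪ m) (c s : n → ℝ) (h : ∀ k, c k ^ 2 + s k ^ 2 = 1) :
    planeRotations j c s ∈ unitaryGroup (m ⊕ n) ℂ := by
  have h' : ∀ k, (c k : ℂ) * c k + s k * s k = 1 := fun k => by
    have := h k
    simp only [sq] at this
    exact_mod_cast this
  rw [mem_unitaryGroup_iff', star_eq_conjTranspose, planeRotations, fromBlocks_conjTranspose,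
    fromBlocks_multiply, ← fromBlocks_one, fromBlocks_inj]
  have hconj : ∀ (p : Prop) [Decidable p] (z : ℝ),
      (starRingEnd ℂ) (if p then (z : ℂ) else 0) = if p then (z : ℂ) else 0 := by
    intro p _ z
    split_ifs <;> simp
  have hconj' : ∀ (p : Prop) [Decidable p] (z : ℝ),
      (starRingEnd ℂ) (if p then -(z : ℂ) else 0) = if p then -(z : ℂ) else 0 := by
    intro p _ z
    split_ifs <;> simp
  refine ⟨?_, ?_, ?_, ?_⟩
  · ext i i'
    by_cases hi : ∃ k, j k = i
    · obtain ⟨k, rfl⟩ := hi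
      by_cases hi' : ∃ l, j l = i'
      · obtain ⟨l, rfl⟩ := hi'
        by_cases hkl : k = l
        · subst hkl
          simp [Matrix.mul_apply, j.injective.eq_iff, j.injective.extend_apply, hconj', h']
        · simp [Matrix.mul_apply, j.injective.eq_iff, hconj', hkl]
      · have hk : j k ≠ i' := fun e => hi' ⟨k, e⟩
        have hk' : ∀ l, i' ≠ j l := fun l e => hi' ⟨l, e.symm⟩
        simp [Matrix.mul_apply, hk, hk']
    · have hk : ∀ k, i ≠ j k := fun k e => hi ⟨k, e.symm⟩
      simp [Matrix.mul_apply, diagonal_apply, Matrix.one_apply, hk,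
        Function.extend_apply' _ _ _ hi]
  · ext i k
    by_cases hi : ∃ k, j k = i
    · obtain ⟨l, rfl⟩ := hi
      by_cases hkl : l = k
      · subst hkl
        simp [Matrix.mul_apply, diagonal_apply, j.injective.eq_iff, j.injective.extend_apply,
          hconj', mul_comm]
      · simp [Matrix.mul_apply, diagonal_apply, j.injective.eq_iff, hkl]
    · have hk : ∀ k, i ≠ j k := fun k e => hi ⟨k, e.symm⟩
      simp [Matrix.mul_apply, diagonal_apply, hk]
  · ext k i
    by_cases hi : ∃ k, j k = i
    · obtain ⟨l, rfl⟩ := hi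
      by_cases hkl : l = k
      · subst hkl
        simp [Matrix.mul_apply, diagonal_apply, j.injective.eq_iff, j.injective.extend_apply,
          hconj, mul_comm]
      · simp [Matrix.mul_apply, diagonal_apply, j.injective.eq_iff, hkl, Ne.symm hkl]
    · have hk : ∀ k, i ≠ j k := fun k e => hi ⟨k, e.symm⟩
      simp [Matrix.mul_apply, diagonal_apply, hk]
  · ext k l
    by_cases hkl : k = l
    · subst hkl
      simp [Matrix.mul_apply, hconj, add_comm, h']
    · simp [Matrix.mul_apply, j.injective.eq_iff, hkl, Ne.symm hkl]

theorem blockDiagWrt_planeRotations {m n κ : Type*} [DecidableEq m] [DecidableEq n] (j : n ↪ m)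
    (c s : n → ℝ) (β : m ⊕ n → κ) (hβ : ∀ k, β (.inl (j k)) = β (.inr k)) :
    BlockDiagWrt β (planeRotations j c s) := by
  rintro (i | k) (i' | l) h
  · exact if_neg (fun (e : i = i') => h (e ▸ rfl))
  · exact if_neg (fun (e : i = j l) => h (e ▸ hβ l))
  · exact if_neg (fun (e : i' = j k) => h (e ▸ (hβ k).symm))
  · exact if_neg (fun (e : k = l) => h (e ▸ rfl))

/-- **Cosine-sine decomposition**, with an arbitrary pairing `j` of the second block's indices
with indices of the first block. -/
theorem exists_cosineSine {m n : Type*} [Fintype m] [DecidableEq m] [Fintype n]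
    [DecidableEq n] (j : n ↪ m) {U : Matrix (m ⊕ n) (m ⊕ n) ℂ}
    (hU : U ∈ unitaryGroup (m ⊕ n) ℂ) :
    ∃ X ∈ unitaryGroup m ℂ, ∃ W ∈ unitaryGroup n ℂ, ∃ R ∈ unitaryGroup m ℂ,
      ∃ V ∈ unitaryGroup n ℂ, ∃ c s : n → ℝ, (∀ k, c k ^ 2 + s k ^ 2 = 1) ∧
        U = fromBlocks X 0 0 W * planeRotations j c s * fromBlocks R 0 0 V := by
  obtain ⟨A, B, C, D, rfl⟩ : ∃ A B C D, U = fromBlocks A B C D :=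
    ⟨_, _, _, _, (fromBlocks_toBlocks U).symm⟩
  have hBD : Bᴴ * B + Dᴴ * D = 1 := by
    have h := mem_unitaryGroup_iff'.1 hU
    rw [star_eq_conjTranspose, fromBlocks_conjTranspose, fromBlocks_multiply, ← fromBlocks_one,
      fromBlocks_inj] at h
    exact h.2.2.2
  have hH : (Dᴴ * D).IsHermitian := isHermitian_conjTranspose_mul_self D
  obtain ⟨V, hV, μ, hD⟩ : ∃ V ∈ unitaryGroup n ℂ, ∃ μ : n → ℝ,
      Vᴴ * (Dᴴ * D) * V = diagonal fun k => (μ k : ℂ) := by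
    refine ⟨hH.eigenvectorUnitary, hH.eigenvectorUnitary.2, hH.eigenvalues, ?_⟩
    have := hH.conjStarAlgAut_star_eigenvectorUnitary
    rw [Unitary.conjStarAlgAut_apply] at this
    simpa [star_eq_conjTranspose, Function.comp_def] using this
  have hVV : Vᴴ * V = 1 := mem_unitaryGroup_iff'.1 hV
  have hVV' : V * Vᴴ = 1 := mem_unitaryGroup_iff.1 hV
  obtain ⟨hμ, W, hW, hDW⟩ := exists_unitary_mul_sqrt (Function.Embedding.refl n) (D * V) μ
    (by rw [← hD]; simp only [conjTranspose_mul, Matrix.mul_assoc])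
  obtain ⟨hν, X, hX, hBX⟩ := exists_unitary_mul_sqrt j (B * V) (fun k => 1 - μ k) (by
    have : (B * V)ᴴ * (B * V) = Vᴴ * (Bᴴ * B + Dᴴ * D) * V - Vᴴ * (Dᴴ * D) * V := by
      simp only [conjTranspose_mul, Matrix.mul_assoc, Matrix.mul_add, Matrix.add_mul]
      abel
    rw [this, hBD, Matrix.mul_one, hVV, hD, ← diagonal_one, diagonal_sub]
    simp)
  have hcs : ∀ k, √(μ k) ^ 2 + √(1 - μ k) ^ 2 = 1 := fun k => by
    rw [Real.sq_sqrt (hμ k), Real.sq_sqrt (hν k)]; ring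
  set M := planeRotations j (fun k => √(μ k)) (fun k => √(1 - μ k)) with hM
  have hMu : M ∈ unitaryGroup (m ⊕ n) ℂ := planeRotations_mem_unitaryGroup j _ _ hcs
  have hLu := fromBlocks_mem_unitaryGroup hX hW
  have hRu := fromBlocks_mem_unitaryGroup (one_mem (unitaryGroup m ℂ)) hV
  set G : Matrix (m ⊕ n) (m ⊕ n) ℂ := fromBlocks 1 0 0 V with hG
  set L : Matrix (m ⊕ n) (m ⊕ n) ℂ := fromBlocks X 0 0 W with hL
  have hcol : ∀ x k, (fromBlocks A B C D * G) x (.inr k) = (L * M) x (.inr k) := by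
    rw [hL, hM, hG, planeRotations, fromBlocks_multiply, fromBlocks_multiply]
    rintro (i | l) k
    · simp [hBX, Matrix.mul_apply]
    · simp [hDW]
  set N := star M * (star L * (fromBlocks A B C D * G)) with hN
  have hNu : N ∈ unitaryGroup (m ⊕ n) ℂ :=
    mul_mem (Unitary.star_mem hMu) (mul_mem (Unitary.star_mem hLu) (mul_mem hU hRu))
  have hNcol : ∀ x k, N x (.inr k) = (1 : Matrix (m ⊕ n) (m ⊕ n) ℂ) x (.inr k) := by
    intro x k
    have h1 : star M * (star L * (L * M)) = 1 := by
      rw [← Matrix.mul_assoc (star L), mem_unitaryGroup_iff'.1 hLu, Matrix.one_mul,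
        mem_unitaryGroup_iff'.1 hMu]
    rw [← h1, hN, ← Matrix.mul_assoc, ← Matrix.mul_assoc (star M) (star L) (L * M),
      Matrix.mul_apply, Matrix.mul_apply]
    simp only [hcol]
  obtain ⟨R, hR, hNR⟩ := exists_fromBlocks_of_lastCol hNu
    (by ext i k; simp [toBlocks₁₂, hNcol]) (by ext l k; simp [toBlocks₂₂, hNcol, Matrix.one_apply])
  refine ⟨X, hX, W, hW, R, hR, Vᴴ, Unitary.star_mem hV, _, _, hcs, ?_⟩
  have h2 : fromBlocks R 0 0 Vᴴ = N * fromBlocks 1 0 0 Vᴴ := by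
    rw [hNR, fromBlocks_multiply]; simp
  have h3 : G * fromBlocks 1 0 0 Vᴴ = 1 := by
    rw [hG, fromBlocks_multiply]; simp [hVV']
  have h4 : M * star M = 1 := mem_unitaryGroup_iff.1 hMu
  have h5 : L * star L = 1 := mem_unitaryGroup_iff.1 hLu
  rw [h2, hN]
  symm
  calc L * M * (star M * (star L * (fromBlocks A B C D * G)) *
        fromBlocks 1 0 0 Vᴴ)
      = L * (M * star M) * star L * fromBlocks A B C D *
          (G * fromBlocks 1 0 0 Vᴴ) := by simp only [Matrix.mul_assoc]
    _ = fromBlocks A B C D := by rw [h3, h4, Matrix.mul_one, Matrix.mul_one, h5, Matrix.one_mul]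

/-- `U` is an alternating product of `2 * k + 1` unitaries, block diagonal with respect to
`α`, `β`, `α`, …, `α`. -/
def IsAlternatingProd {ι a b : Type*} [Fintype ι] [DecidableEq ι] (α : ι → a) (β : ι → b) :
    ℕ → Matrix ι ι ℂ → Prop
  | 0, U => U ∈ unitaryGroup ι ℂ ∧ BlockDiagWrt α U
  | k + 1, U => ∃ V M W, IsAlternatingProd α β k V ∧
      (M ∈ unitaryGroup ι ℂ ∧ BlockDiagWrt β M) ∧ (W ∈ unitaryGroup ι ℂ ∧ BlockDiagWrt α W) ∧
      U = V * M * W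

namespace IsAlternatingProd

variable {ι ι' a b a' a'' : Type*} [Fintype ι] [DecidableEq ι] [Fintype ι'] [DecidableEq ι']

theorem mul_mul {α : ι → a} {β : ι → b} {k l : ℕ} {V M W : Matrix ι ι ℂ}
    (hV : IsAlternatingProd α β k V) (hM : M ∈ unitaryGroup ι ℂ) (hMβ : BlockDiagWrt β M)
    (hW : IsAlternatingProd α β l W) : IsAlternatingProd α β (k + l + 1) (V * M * W) := by
  induction l generalizing W with
  | zero => exact ⟨V, M, W, hV, ⟨hM, hMβ⟩, hW, rfl⟩
  | succ l ih =>
    obtain ⟨V', M', W', hV', hM', hW', rfl⟩ := hW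
    exact ⟨V * M * V', M', W', ih hV', hM', hW', by simp only [Matrix.mul_assoc]⟩

theorem submatrix {α : ι → a} {β : ι → b} {k : ℕ} {U : Matrix ι ι ℂ} (e : ι' ≃ ι)
    (hU : IsAlternatingProd α β k U) :
    IsAlternatingProd (α ∘ e) (β ∘ e) k (U.submatrix e e) := by
  have hu : ∀ {M : Matrix ι ι ℂ}, M ∈ unitaryGroup ι ℂ →
      M.submatrix e e ∈ unitaryGroup ι' ℂ := by
    intro M hM
    rw [mem_unitaryGroup_iff', star_eq_conjTranspose] at *
    rw [conjTranspose_submatrix, submatrix_mul_equiv, hM, submatrix_one_equiv]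
  induction k generalizing U with
  | zero => exact ⟨hu hU.1, fun x y h => hU.2 _ _ h⟩
  | succ k ih =>
    obtain ⟨V, M, W, hV, hM, hW, rfl⟩ := hU
    exact ⟨_, _, _, ih hV, ⟨hu hM.1, fun x y h => hM.2 _ _ h⟩,
      ⟨hu hW.1, fun x y h => hW.2 _ _ h⟩, by simp only [submatrix_mul_equiv]⟩

theorem fromBlocks {α : ι → a} {β : ι → b} {α' : ι' → a'} {β' : ι' → b} {γ : ι ⊕ ι' → a''}
    {k : ℕ} {U : Matrix ι ι ℂ} {U' : Matrix ι' ι' ℂ}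
    (hγ : ∀ x y, α x = α y → γ (.inl x) = γ (.inl y))
    (hγ' : ∀ x y, α' x = α' y → γ (.inr x) = γ (.inr y))
    (hU : IsAlternatingProd α β k U) (hU' : IsAlternatingProd α' β' k U') :
    IsAlternatingProd γ (Sum.elim β β') k (Matrix.fromBlocks U 0 0 U') := by
  have hα : ∀ {M M'}, BlockDiagWrt α M → BlockDiagWrt α' M' →
      BlockDiagWrt γ (Matrix.fromBlocks M 0 0 M') := by
    rintro M M' h h' (x | x) (y | y) hxy
    exacts [h _ _ (mt (hγ x y) hxy), rfl, rfl, h' _ _ (mt (hγ' x y) hxy)]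
  have hβ : ∀ {M M'}, BlockDiagWrt β M → BlockDiagWrt β' M' →
      BlockDiagWrt (Sum.elim β β') (Matrix.fromBlocks M 0 0 M') := by
    rintro M M' h h' (x | x) (y | y) hxy
    exacts [h _ _ hxy, rfl, rfl, h' _ _ hxy]
  induction k generalizing U U' with
  | zero => exact ⟨fromBlocks_mem_unitaryGroup hU.1 hU'.1, hα hU.2 hU'.2⟩
  | succ k ih =>
    obtain ⟨V, M, W, hV, hM, hW, rfl⟩ := hU
    obtain ⟨V', M', W', hV', hM', hW', rfl⟩ := hU'
    exact ⟨_, _, _, ih hV hV', ⟨fromBlocks_mem_unitaryGroup hM.1 hM'.1, hβ hM.2 hM'.2⟩,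
      ⟨fromBlocks_mem_unitaryGroup hW.1 hW'.1, hα hW.2 hW'.2⟩, by simp [fromBlocks_multiply]⟩

/-- The factors of an alternating product, as a sequence. -/
theorem exists_factors {α : ι → a} {β : ι → b} {k : ℕ} {U : Matrix ι ι ℂ}
    (hU : IsAlternatingProd α β k U) :
    ∃ f : ℕ → Matrix ι ι ℂ, (∀ i, f i ∈ unitaryGroup ι ℂ) ∧
      (∀ i, Even i → BlockDiagWrt α (f i)) ∧ (∀ i, Odd i → BlockDiagWrt β (f i)) ∧
      U = ((List.range (2 * k + 1)).map f).prod := by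
  induction k generalizing U with
  | zero =>
    refine ⟨fun i => if i = 0 then U else 1, fun i => ?_, fun i _ => ?_, fun i hi => ?_, by simp⟩
    · dsimp only
      split_ifs
      exacts [hU.1, one_mem _]
    · dsimp only
      split_ifs
      exacts [hU.2, blockDiagWrt_one α]
    · dsimp only
      rw [if_neg (by rintro rfl; simp at hi)]
      exact blockDiagWrt_one β
  | succ k ih =>
    obtain ⟨V, M, W, hV, hM, hW, rfl⟩ := hU
    obtain ⟨f, hf, hfα, hfβ, rfl⟩ := ih hV
    refine ⟨fun i => if i = 2 * k + 1 then M else if i = 2 * k + 2 then W else f i,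
      fun i => ?_, fun i hi => ?_, fun i hi => ?_, ?_⟩
    · dsimp only
      split_ifs
      exacts [hM.1, hW.1, hf i]
    · have hne : i ≠ 2 * k + 1 := by grind
      dsimp only
      rw [if_neg hne]
      split_ifs
      exacts [hW.2, hfα i hi]
    · dsimp only
      split_ifs
      · exact hM.2
      · grind
      · exact hfβ i hi
    · have hlist : List.range (2 * (k + 1) + 1) =
          List.range (2 * k + 1) ++ [2 * k + 1] ++ [2 * k + 2] := by
        rw [← List.range_succ, ← List.range_succ]
        rfl
      simp only [hlist, List.map_append, List.prod_append, List.map_singleton,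
        List.prod_singleton]
      congr 1
      · congr 1
        · congr 1
          refine List.map_congr_left fun i hi => ?_
          rw [List.mem_range] at hi
          rw [if_neg (by omega), if_neg (by omega)]
      · simp

end IsAlternatingProd

theorem isAlternatingProd_of_le_two_pow (b : Type*) [Fintype b] [DecidableEq b] (n d : ℕ)
    (hd : d ≤ 2 ^ n) (U : Matrix (Fin d × b) (Fin d × b) ℂ)
    (hU : U ∈ unitaryGroup (Fin d × b) ℂ) :
    IsAlternatingProd Prod.fst Prod.snd (2 ^ n - 1) U := by
  induction n generalizing d with
  | zero =>
    have : Subsingleton (Fin d) := Fin.subsingleton_iff_le_one.2 (by simpa using hd)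
    exact ⟨hU, fun x y h => (h (Subsingleton.elim _ _)).elim⟩
  | succ n ih =>
    obtain ⟨p, q, rfl, hp, hqp⟩ : ∃ p q, d = p + q ∧ p ≤ 2 ^ n ∧ q ≤ p :=
      ⟨d - d / 2, d / 2, by omega, by rw [pow_succ] at hd; omega, by omega⟩
    let e : (Fin p × b) ⊕ (Fin q × b) ≃ Fin (p + q) × b :=
      (Equiv.sumProdDistrib _ _ _).symm.trans (finSumFinEquiv.prodCongr (Equiv.refl b))
    let j : Fin q × b ↪ Fin p × b := (Fin.castLEEmb hqp).prodMap (Function.Embedding.refl b)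
    have hUe : U.submatrix e e ∈ unitaryGroup ((Fin p × b) ⊕ (Fin q × b)) ℂ := by
      rw [mem_unitaryGroup_iff', star_eq_conjTranspose] at *
      rw [conjTranspose_submatrix, submatrix_mul_equiv, hU, submatrix_one_equiv]
    obtain ⟨X, hX, W, hW, R, hR, V, hV, c, s, hcs, h⟩ := exists_cosineSine j hUe
    have hblock : ∀ {Y Z}, Y ∈ unitaryGroup (Fin p × b) ℂ → Z ∈ unitaryGroup (Fin q × b) ℂ →
        IsAlternatingProd (Prod.fst ∘ e) (Prod.snd ∘ e) (2 ^ n - 1) (fromBlocks Y 0 0 Z) := by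
      intro Y Z hY hZ
      have hβ : Prod.snd ∘ e = Sum.elim Prod.snd Prod.snd := by
        ext (x | x) <;> rfl
      rw [hβ]
      refine (ih p hp Y hY).fromBlocks ?_ ?_ (ih q (hqp.trans hp) Z hZ)
      · rintro ⟨x, k⟩ ⟨y, l⟩ (rfl : x = y)
        rfl
      · rintro ⟨x, k⟩ ⟨y, l⟩ (rfl : x = y)
        rfl
    have hmain := ((hblock hX hW).mul_mul (planeRotations_mem_unitaryGroup j c s hcs)
      (blockDiagWrt_planeRotations j c s _ (fun k => rfl)) (hblock hR hV)).submatrix e.symm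
    rw [← h] at hmain
    have hk : 2 ^ n - 1 + (2 ^ n - 1) + 1 = 2 ^ (n + 1) - 1 := by
      have := Nat.one_le_two_pow (n := n)
      rw [pow_succ]
      omega
    rw [hk] at hmain
    simpa [Function.comp_assoc] using hmain

theorem two_pow_clog_le {d : ℕ} (hd : 2 ≤ d) : 2 ^ (Nat.clog 2 d + 1) - 1 ≤ 4 * d - 5 := by
  have h := Nat.pow_pred_clog_lt_self (b := 2) (by norm_num) (x := d) (by omega)
  have hpos : 0 < Nat.clog 2 d := Nat.clog_pos (by norm_num) hd
  obtain ⟨n, hn⟩ := Nat.exists_eq_succ_of_ne_zero hpos.ne'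
  rw [hn] at h ⊢
  simp only [Nat.succ_eq_add_one, Nat.pred_eq_sub_one, Nat.add_sub_cancel, pow_succ] at h ⊢
  omega

/-- Every unitary on the `d_A × d_B` system (`d_A ≥ 2`, `d_B ≥ 1`) has a
`(2^(⌈log₂ d_A⌉ + 1) − 1)`-sandwich form; in particular it is the product of at most
`4 d_A − 5` unitaries each controlled in the computational basis from the A or B side. -/
theorem sandwich_form_general (dA dB : ℕ) (hdA : 2 ≤ dA) (hdB : 1 ≤ dB)
    (U : Matrix (Fin dA × Fin dB) (Fin dA × Fin dB) ℂ)
    (hU : U ∈ Matrix.unitaryGroup (Fin dA × Fin dB) ℂ) :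
    HasSandwichForm (2 ^ (Nat.clog 2 dA + 1) - 1) U ∧
    ∃ m : ℕ, m ≤ 4 * dA - 5 ∧
      ∃ f : Fin m → Matrix (Fin dA × Fin dB) (Fin dA × Fin dB) ℂ,
        (∀ i, f i ∈ Matrix.unitaryGroup (Fin dA × Fin dB) ℂ) ∧
        (∀ i, CtrlAcb (f i) ∨ CtrlBcb (f i)) ∧
        U = (List.ofFn f).prod := by
  have hform : HasSandwichForm (2 ^ (Nat.clog 2 dA + 1) - 1) U := by
    obtain ⟨f, hf, hfα, hfβ, rfl⟩ := (isAlternatingProd_of_le_two_pow (Fin dB) (Nat.clog 2 dA) dA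
      (Nat.le_pow_clog (by norm_num) dA) U hU).exists_factors
    have hk : 2 * (2 ^ Nat.clog 2 dA - 1) + 1 = 2 ^ (Nat.clog 2 dA + 1) - 1 := by
      have := Nat.one_le_two_pow (n := Nat.clog 2 dA)
      rw [pow_succ]
      omega
    refine ⟨fun i => f i, fun i => hf i, fun i hi => hfα i (by grind),
      fun i hi => hfβ i (by grind), ?_⟩
    rw [hk, List.ofFn_eq_map, ← List.map_coe_finRange_eq_range, List.map_map]
    rfl
  refine ⟨hform, _, two_pow_clog_le hdA, ?_⟩
  obtain ⟨f, hf, hA, hB, hprod⟩ := hform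
  refine ⟨f, hf, fun i => ?_, hprod⟩
  rcases Nat.even_or_odd ((i : ℕ) + 1) with h | h
  exacts [.inr (hB i h), .inl (hA i h)]
end

section
/- Suppose that for every odd d ≥ 3 and every d_B ≥ 1, every unitary on the d × d_B system has a (2d − 1)-sandwich form. Then for every even d_A ≥ 2 and every d_B ≥ 1, every unitary on the d_A × d_B system has a (2·d_A − 1)-sandwich form. -/
open Matrix Kronecker BigOperators

open scoped ComplexOrder

namespace Matrix

variable {n : Type*} [Fintype n] [DecidableEq n]

/-- A matrix whose columns are orthogonal with norms `|d i|` factors as a unitary times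
`diagonal d`. -/
theorem exists_unitary_mul_diagonal (M : Matrix n n ℂ) (d : n → ℝ)
    (h : Mᴴ * M = diagonal fun i => ((d i * d i : ℝ) : ℂ)) :
    ∃ V ∈ unitaryGroup n ℂ, M = V * diagonal fun i => (d i : ℂ) := by
  have hinner : ∀ i j, inner ℂ (WithLp.toLp 2 (M.col i)) (WithLp.toLp 2 (M.col j)) =
      if i = j then ((d i * d i : ℝ) : ℂ) else 0 := by
    intro i j
    rw [← diagonal_apply (d := fun i => ((d i * d i : ℝ) : ℂ)), ← h, mul_apply,
      PiLp.inner_apply]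
    exact Finset.sum_congr rfl fun k _ => by simp [mul_comm]
  let v : n → EuclideanSpace ℂ n := fun i => ((d i : ℂ)⁻¹) • WithLp.toLp 2 (M.col i)
  have hv : Orthonormal ℂ (({i | d i ≠ 0} : Set n).domRestrict v) := by
    rw [orthonormal_iff_ite]
    rintro ⟨i, hi⟩ ⟨j, hj⟩
    have hi' : (d i : ℂ) ≠ 0 := by exact_mod_cast hi
    simp only [Set.domRestrict_apply, v, inner_smul_left, inner_smul_right, hinner,
      Subtype.mk.injEq]
    split_ifs with hij
    · subst hij
      simp
      field_simp
    · simp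
  obtain ⟨b, hb⟩ := hv.exists_orthonormalBasis_extension_of_card_eq (by simp)
  refine ⟨(EuclideanSpace.basisFun n ℂ).toBasis.toMatrix b,
    OrthonormalBasis.toMatrix_orthonormalBasis_mem_unitary _ _, ?_⟩
  ext i j
  rw [mul_diagonal]
  simp only [Module.Basis.toMatrix_apply, OrthonormalBasis.coe_toBasis_repr_apply,
    EuclideanSpace.basisFun_repr]
  by_cases hj : d j = 0
  · have h0 := hinner j j
    simp only [hj, mul_zero, Complex.ofReal_zero, if_true, inner_self_eq_zero] at h0
    simpa [hj] using congrArg (fun x : EuclideanSpace ℂ n => x i) h0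
  · have hj' : (d j : ℂ) ≠ 0 := by exact_mod_cast hj
    rw [hb j hj]
    simp [v]
    field_simp

/-- A unitary block matrix with three blocks in cosine-sine form differs from a cosine-sine
matrix by a unitary acting on the fourth block. -/
theorem exists_unitary_of_cosine_sine_corner {c s : n → ℝ} (hc : ∀ i, 0 ≤ c i)
    (hcs : ∀ i, c i * c i + s i * s i = 1) {D : Matrix n n ℂ}
    (h₁ : diagonal (fun i => (s i : ℂ)) * D = diagonal fun i => (s i * c i : ℂ))
    (h₂ : D * diagonal (fun i => (s i : ℂ)) = diagonal fun i => (s i * c i : ℂ))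
    (h₃ : Dᴴ * D = diagonal fun i => (c i * c i : ℂ)) :
    ∃ E ∈ unitaryGroup n ℂ, E * diagonal (fun i => (c i : ℂ)) = D ∧
      E * diagonal (fun i => (s i : ℂ)) = diagonal fun i => (s i : ℂ) := by
  set C : Matrix n n ℂ := diagonal fun i => (c i : ℂ) with hC
  set S : Matrix n n ℂ := diagonal fun i => (s i : ℂ) with hS
  set T : Matrix n n ℂ := diagonal fun i => ((s i / (1 + c i) : ℝ) : ℂ) with hT
  have hST : S * T = 1 - C := by
    rw [hS, hT, hC, diagonal_mul_diagonal, ← diagonal_one, diagonal_sub]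
    congr 1
    ext i
    have h0 : 1 + c i ≠ 0 := by linarith [hc i]
    rw [← Complex.ofReal_mul, ← Complex.ofReal_one, ← Complex.ofReal_sub]
    congr 1
    field_simp
    linarith [hcs i]
  have hTS : T * S = 1 - C := by
    rw [← hST, hS, hT, diagonal_mul_diagonal, diagonal_mul_diagonal]
    simp only [mul_comm]
  have hSC : (diagonal fun i => (s i * c i : ℂ)) = S * C := by
    rw [hS, hC, diagonal_mul_diagonal]
  have hCS : (diagonal fun i => (s i * c i : ℂ)) = C * S := by
    rw [hS, hC, diagonal_mul_diagonal]
    simp only [mul_comm]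
  have hCH : Cᴴ = C := by
    rw [hC, diagonal_conjTranspose]
    congr 1
    ext i
    simp
  have hDr : D * (1 - C) = C * (1 - C) := by
    rw [← hST, ← mul_assoc, h₂, hCS, mul_assoc]
  have hDl : (1 - C) * D = (1 - C) * C := by
    rw [← hTS, mul_assoc, h₁, hSC, mul_assoc]
  have hDl' : Dᴴ * (1 - C) = C * (1 - C) := by
    simpa [hCH] using congrArg conjTranspose hDl
  have h₃' : Dᴴ * D = C * C := by rw [h₃, hC, diagonal_mul_diagonal]
  refine ⟨D + (1 - C), ?_, ?_, ?_⟩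
  · rw [mem_unitaryGroup_iff', star_eq_conjTranspose]
    simp only [conjTranspose_add, conjTranspose_sub, conjTranspose_one, hCH]
    rw [add_mul, mul_add, mul_add, hDl', hDl, h₃']
    noncomm_ring
  · have : D = D * C + C * (1 - C) := by rw [← hDr]; noncomm_ring
    calc (D + (1 - C)) * C = D * C + C * (1 - C) := by noncomm_ring
      _ = D := this.symm
  · rw [add_mul, h₂, hCS]
    noncomm_ring

theorem fromBlocks_diagonal_mem_unitaryGroup_s7 {V W : Matrix n n ℂ}
    (hV : V ∈ unitaryGroup n ℂ) (hW : W ∈ unitaryGroup n ℂ) :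
    fromBlocks V 0 0 W ∈ unitaryGroup (n ⊕ n) ℂ := by
  rw [mem_unitaryGroup_iff, star_eq_conjTranspose] at *
  simp [fromBlocks_conjTranspose, fromBlocks_multiply, hV, hW]

/-- **Cosine-sine decomposition** of a unitary matrix split into four square blocks of equal
size. -/
theorem exists_cosine_sine_decomposition_s7 {U : Matrix (n ⊕ n) (n ⊕ n) ℂ}
    (hU : U ∈ unitaryGroup (n ⊕ n) ℂ) :
    ∃ V₁ ∈ unitaryGroup n ℂ, ∃ V₂ ∈ unitaryGroup n ℂ, ∃ W₁ ∈ unitaryGroup n ℂ,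
      ∃ W₂ ∈ unitaryGroup n ℂ, ∃ c s : n → ℝ, (∀ i, c i * c i + s i * s i = 1) ∧
      U = fromBlocks V₁ 0 0 V₂ *
        fromBlocks (diagonal fun i => (c i : ℂ)) (-diagonal fun i => (s i : ℂ))
          (diagonal fun i => (s i : ℂ)) (diagonal fun i => (c i : ℂ)) *
        fromBlocks W₁ 0 0 W₂ := by
  obtain ⟨A, B, C, D, rfl⟩ : ∃ A B C D, U = fromBlocks A B C D :=
    ⟨_, _, _, _, (fromBlocks_toBlocks U).symm⟩
  have hcol := mem_unitaryGroup_iff'.1 hU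
  have hrow := mem_unitaryGroup_iff.1 hU
  rw [star_eq_conjTranspose, fromBlocks_conjTranspose, fromBlocks_multiply, ← fromBlocks_one,
    fromBlocks_inj] at hcol hrow
  obtain ⟨hcol₁₁, hcol₁₂, -, hcol₂₂⟩ := hcol
  obtain ⟨hrow₁₁, -, hrow₂₁, -⟩ := hrow
  have hA : (Aᴴ * A).PosSemidef := posSemidef_conjTranspose_mul_self A
  set W : Matrix n n ℂ := (hA.1.eigenvectorUnitary).1
  have hW : W ∈ unitaryGroup n ℂ := hA.1.eigenvectorUnitary.2
  have hWW : Wᴴ * W = 1 := mem_unitaryGroup_iff'.1 hW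
  have hWW' : W * Wᴴ = 1 := mem_unitaryGroup_iff.1 hW
  have hspec : Aᴴ * A = W * diagonal (fun i => (hA.1.eigenvalues i : ℂ)) * Wᴴ := by
    conv_lhs => rw [hA.1.spectral_theorem, Unitary.conjStarAlgAut_apply]
    rfl
  have hAW : (A * W)ᴴ * (A * W) = diagonal fun i => (hA.1.eigenvalues i : ℂ) := by
    calc (A * W)ᴴ * (A * W) = Wᴴ * (Aᴴ * A) * W := by
          simp only [conjTranspose_mul, mul_assoc]
      _ = (Wᴴ * W) * diagonal (fun i => (hA.1.eigenvalues i : ℂ)) * (Wᴴ * W) :=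
          (congrArg (Wᴴ * · * W) hspec).trans (by simp only [mul_assoc])
      _ = _ := by rw [hWW, one_mul, mul_one]
  have hCW : (C * W)ᴴ * (C * W) = diagonal fun i => ((1 - hA.1.eigenvalues i : ℝ) : ℂ) := by
    have h1 : (A * W)ᴴ * (A * W) + (C * W)ᴴ * (C * W) = 1 := by
      calc _ = Wᴴ * (Aᴴ * A + Cᴴ * C) * W := by
            simp only [conjTranspose_mul, mul_assoc, add_mul, mul_add]
        _ = 1 := by rw [hcol₁₁, mul_one, hWW]
    rw [eq_sub_of_add_eq' h1, hAW, ← diagonal_one, diagonal_sub]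
    simp
  have hle : ∀ i, 0 ≤ 1 - hA.1.eigenvalues i := by
    intro i
    have h := (posSemidef_conjTranspose_mul_self (C * W)).diag_nonneg (i := i)
    rw [hCW, diagonal_apply_eq] at h
    exact_mod_cast h
  set c : n → ℝ := fun i => √(hA.1.eigenvalues i) with hc
  set s : n → ℝ := fun i => √(1 - hA.1.eigenvalues i) with hs
  have hcc : ∀ i, c i * c i = hA.1.eigenvalues i := fun i =>
    Real.mul_self_sqrt (hA.eigenvalues_nonneg i)
  have hss : ∀ i, s i * s i = 1 - hA.1.eigenvalues i := fun i => Real.mul_self_sqrt (hle i)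
  have hcs : ∀ i, c i * c i + s i * s i = 1 := fun i => by rw [hcc, hss]; ring
  have hc₀ : ∀ i, 0 ≤ c i := fun i => Real.sqrt_nonneg _
  simp only [← hcc] at hAW
  simp only [← hss] at hCW
  obtain ⟨V, hV, hAV⟩ := exists_unitary_mul_diagonal _ _ hAW
  obtain ⟨V', hV', hCV⟩ := exists_unitary_mul_diagonal _ _ hCW
  clear_value c s W
  have hVV : Vᴴ * V = 1 := mem_unitaryGroup_iff'.1 hV
  have hVV' : V * Vᴴ = 1 := mem_unitaryGroup_iff.1 hV
  have hV'V : V'ᴴ * V' = 1 := mem_unitaryGroup_iff'.1 hV'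
  have hV'V' : V' * V'ᴴ = 1 := mem_unitaryGroup_iff.1 hV'
  set Γ : Matrix n n ℂ := diagonal fun i => (c i : ℂ) with hΓ
  set S : Matrix n n ℂ := diagonal fun i => (s i : ℂ) with hS
  have hΓH : Γᴴ = Γ := by
    rw [hΓ, diagonal_conjTranspose]; congr 1; ext i; simp
  have hSH : Sᴴ = S := by
    rw [hS, diagonal_conjTranspose]; congr 1; ext i; simp
  have hΓS : Γ * Γ + S * S = 1 := by
    rw [hΓ, hS, diagonal_mul_diagonal, diagonal_mul_diagonal, diagonal_add, ← diagonal_one]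
    congr 1; ext i; exact_mod_cast hcs i
  have hcomm : Γ * S = S * Γ := by
    rw [hΓ, hS, diagonal_mul_diagonal, diagonal_mul_diagonal]; simp only [mul_comm]
  have hAeq : A = V * Γ * Wᴴ := by rw [← hAV, mul_assoc, hWW', mul_one]
  have hCeq : C = V' * S * Wᴴ := by rw [← hCV, mul_assoc, hWW', mul_one]
  have hVB : (Bᴴ * V)ᴴ * (Bᴴ * V) = 1 - Γ * Γ := by
    calc _ = Vᴴ * (B * Bᴴ) * V := by
          simp only [conjTranspose_mul, conjTranspose_conjTranspose, mul_assoc]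
      _ = Vᴴ * (1 - A * Aᴴ) * V := by rw [← hrow₁₁]; simp
      _ = Vᴴ * V - (Vᴴ * V) * Γ * (Wᴴ * W) * Γ * (Vᴴ * V) := by
          rw [hAeq]
          simp only [conjTranspose_mul, conjTranspose_conjTranspose, hΓH]
          noncomm_ring
      _ = 1 - Γ * Γ := by simp only [hVV, hWW, one_mul, mul_one]
  obtain ⟨Y, hY, hBY⟩ := exists_unitary_mul_diagonal (Bᴴ * V) s (by
    rw [hVB, ← hΓS, add_sub_cancel_left, hS, diagonal_mul_diagonal]; simp)
  rw [← hS] at hBY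
  have hYY : Yᴴ * Y = 1 := mem_unitaryGroup_iff'.1 hY
  have hYY' : Y * Yᴴ = 1 := mem_unitaryGroup_iff.1 hY
  have hBeq : B = V * S * Yᴴ := by
    have h := congrArg conjTranspose hBY
    simp only [conjTranspose_mul, conjTranspose_conjTranspose, hSH] at h
    rw [mul_assoc, ← h, ← mul_assoc, hVV', one_mul]
  set F : Matrix n n ℂ := -(V'ᴴ * D * Y) with hF
  have hDeq : D = -(V' * F * Yᴴ) := by
    calc D = (V' * V'ᴴ) * D * (Y * Yᴴ) := by rw [hV'V', hYY', one_mul, mul_one]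
      _ = _ := by rw [hF]; noncomm_ring
  have hSF : S * F = S * Γ := by
    have h : Wᴴ * (Aᴴ * B + Cᴴ * D) * Y = 0 := by rw [hcol₁₂]; simp
    have h' : Wᴴ * (Aᴴ * B + Cᴴ * D) * Y =
        (Wᴴ * W) * Γ * (Vᴴ * V) * S * (Yᴴ * Y) -
          (Wᴴ * W) * S * (V'ᴴ * V') * F * (Yᴴ * Y) := by
      rw [hAeq, hBeq, hCeq, hDeq]
      simp only [conjTranspose_mul, conjTranspose_conjTranspose, hΓH, hSH]
      noncomm_ring
    rw [h'] at h
    simp only [hWW, hVV, hYY, hV'V, one_mul, mul_one, sub_eq_zero] at h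
    rw [← h, hcomm]
  have hFS : F * S = S * Γ := by
    have h : V'ᴴ * (C * Aᴴ + D * Bᴴ) * V = 0 := by rw [hrow₂₁]; simp
    have h' : V'ᴴ * (C * Aᴴ + D * Bᴴ) * V =
        (V'ᴴ * V') * S * (Wᴴ * W) * Γ * (Vᴴ * V) -
          (V'ᴴ * V') * F * (Yᴴ * Y) * S * (Vᴴ * V) := by
      rw [hAeq, hBeq, hCeq, hDeq]
      simp only [conjTranspose_mul, conjTranspose_conjTranspose, hΓH, hSH]
      noncomm_ring
    rw [h'] at h
    simp only [hWW, hVV, hYY, hV'V, one_mul, mul_one, sub_eq_zero] at h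
    exact h.symm
  have hFF : Fᴴ * F = Γ * Γ := by
    have h : Yᴴ * (Bᴴ * B + Dᴴ * D) * Y = 1 := by rw [hcol₂₂, mul_one, hYY]
    have h' : Yᴴ * (Bᴴ * B + Dᴴ * D) * Y =
        (Yᴴ * Y) * S * (Vᴴ * V) * S * (Yᴴ * Y) +
          (Yᴴ * Y) * Fᴴ * (V'ᴴ * V') * F * (Yᴴ * Y) := by
      rw [hBeq, hDeq]
      simp only [conjTranspose_mul, conjTranspose_neg, conjTranspose_conjTranspose, hSH]
      noncomm_ring
    rw [h'] at h
    simp only [hVV, hYY, hV'V, one_mul, mul_one] at h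
    rw [eq_sub_of_add_eq' h, ← hΓS, add_sub_cancel_right]
  clear_value F
  have hSΓ : (diagonal fun i => (s i * c i : ℂ)) = S * Γ := by
    rw [hS, hΓ, diagonal_mul_diagonal]
  obtain ⟨E, hE, hEΓ, hES⟩ := exists_unitary_of_cosine_sine_corner hc₀ hcs
    (hSF.trans hSΓ.symm) (hFS.trans hSΓ.symm) (hFF.trans (diagonal_mul_diagonal _ _))
  rw [← hΓ] at hEΓ
  rw [← hS] at hES
  refine ⟨V, hV, V' * E, mul_mem hV' hE, Wᴴ, Unitary.star_mem hW, -Yᴴ, ?_, c, s, hcs, ?_⟩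
  · rw [mem_unitaryGroup_iff, star_eq_conjTranspose]
    simp [hYY]
  · rw [← hΓ, ← hS, fromBlocks_multiply, fromBlocks_multiply]
    simp only [zero_mul, mul_zero, add_zero, zero_add, mul_assoc V' E, hEΓ, hES]
    rw [hAeq, hBeq, hCeq, hDeq]
    congr 1 <;> noncomm_ring

/-- A cosine-sine matrix is unitary. -/
theorem cosine_sine_mem_unitaryGroup {c s : n → ℝ} (hcs : ∀ i, c i * c i + s i * s i = 1) :
    fromBlocks (diagonal fun i => (c i : ℂ)) (-diagonal fun i => (s i : ℂ))
      (diagonal fun i => (s i : ℂ)) (diagonal fun i => (c i : ℂ)) ∈ unitaryGroup (n ⊕ n) ℂ := by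
  have hcs' : ∀ i, (c i * c i + s i * s i : ℂ) = 1 := fun i => by exact_mod_cast hcs i
  have hsc' : ∀ i, (s i * s i + c i * c i : ℂ) = 1 := fun i => by rw [add_comm, hcs']
  rw [mem_unitaryGroup_iff, star_eq_conjTranspose, fromBlocks_conjTranspose, fromBlocks_multiply,
    ← fromBlocks_one, fromBlocks_inj]
  simp [diagonal_conjTranspose, Pi.star_def, hcs', hsc', mul_comm]

end Matrix

section Sandwich

variable {dB m m' : ℕ}

theorem HasSandwichForm.mul {dA : ℕ} {U V : Matrix (Fin dA × Fin dB) (Fin dA × Fin dB) ℂ}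
    (hm : Even m) (hU : HasSandwichForm m U) (hV : HasSandwichForm m' V) :
    HasSandwichForm (m + m') (U * V) := by
  obtain ⟨f, hf, hfA, hfB, rfl⟩ := hU
  obtain ⟨g, hg, hgA, hgB, rfl⟩ := hV
  refine ⟨Fin.append f g, ?_, ?_, ?_, ?_⟩
  · exact Fin.addCases (by simpa using hf) (by simpa using hg)
  · refine Fin.addCases (by simpa using hfA) fun i hi => ?_
    rw [Fin.append_right]
    refine hgA i ?_
    rw [Fin.val_natAdd] at hi
    grind
  · refine Fin.addCases (by simpa using hfB) fun i hi => ?_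
    rw [Fin.append_right]
    refine hgB i ?_
    rw [Fin.val_natAdd] at hi
    grind
  · rw [List.ofFn_fin_append, List.prod_append]

theorem HasSandwichForm.mul_ctrlBcb {dA : ℕ}
    {U D : Matrix (Fin dA × Fin dB) (Fin dA × Fin dB) ℂ}
    (hm : Odd m) (hU : HasSandwichForm m U) (hD : D ∈ Matrix.unitaryGroup (Fin dA × Fin dB) ℂ)
    (hDB : CtrlBcb D) : HasSandwichForm (m + 1) (U * D) := by
  obtain ⟨f, hf, hfA, hfB, rfl⟩ := hU
  refine ⟨Fin.append f fun _ : Fin 1 => D, ?_, ?_, ?_, ?_⟩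
  · exact Fin.addCases (by simpa using hf) (by simpa using hD)
  · refine Fin.addCases (by simpa using hfA) fun i hi => ?_
    rw [Fin.val_natAdd] at hi
    grind
  · exact Fin.addCases (by simpa using hfB) (by simpa using fun _ => hDB)
  · rw [List.ofFn_fin_append, List.prod_append]
    simp

/-- Splitting the first factor of a `(d + d) × d_B` system into two halves. -/
def prodSumEquiv (d dB : ℕ) :
    (Fin d × Fin dB) ⊕ (Fin d × Fin dB) ≃ Fin (d + d) × Fin dB :=
  (Equiv.sumProdDistrib _ _ _).symm.trans (finSumFinEquiv.prodCongr (Equiv.refl _))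

variable {d : ℕ}

theorem reindex_prodSumEquiv_apply (U : Matrix ((Fin d × Fin dB) ⊕ (Fin d × Fin dB))
      ((Fin d × Fin dB) ⊕ (Fin d × Fin dB)) ℂ) (p q : (Fin d × Fin dB) ⊕ (Fin d × Fin dB)) :
    Matrix.reindexAlgEquiv ℂ ℂ (prodSumEquiv d dB) U (prodSumEquiv d dB p) (prodSumEquiv d dB q) =
      U p q := by
  simp

theorem reindex_mem_unitaryGroup {U : Matrix ((Fin d × Fin dB) ⊕ (Fin d × Fin dB))
      ((Fin d × Fin dB) ⊕ (Fin d × Fin dB)) ℂ}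
    (hU : U ∈ Matrix.unitaryGroup ((Fin d × Fin dB) ⊕ (Fin d × Fin dB)) ℂ) :
    Matrix.reindexAlgEquiv ℂ ℂ (prodSumEquiv d dB) U ∈
      Matrix.unitaryGroup (Fin (d + d) × Fin dB) ℂ := by
  rw [Matrix.mem_unitaryGroup_iff] at *
  rw [← map_one (Matrix.reindexAlgEquiv ℂ ℂ (prodSumEquiv d dB)), ← hU, map_mul]
  rfl

theorem ofFn_prod_fromBlocks {X : Type*} [Fintype X] [DecidableEq X]
    (f g : Fin m → Matrix X X ℂ) :
    (List.ofFn fun i => Matrix.fromBlocks (f i) 0 0 (g i)).prod =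
      Matrix.fromBlocks (List.ofFn f).prod 0 0 (List.ofFn g).prod := by
  induction m with
  | zero => simp
  | succ m ih => simp [List.ofFn_succ, ih, Matrix.fromBlocks_multiply]

theorem HasSandwichForm.directSum {U V : Matrix (Fin d × Fin dB) (Fin d × Fin dB) ℂ}
    (hU : HasSandwichForm m U) (hV : HasSandwichForm m V) :
    HasSandwichForm m
      (Matrix.reindexAlgEquiv ℂ ℂ (prodSumEquiv d dB) (Matrix.fromBlocks U 0 0 V)) := by
  obtain ⟨f, hf, hfA, hfB, rfl⟩ := hU
  obtain ⟨g, hg, hgA, hgB, rfl⟩ := hV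
  refine ⟨fun i => Matrix.reindexAlgEquiv ℂ ℂ (prodSumEquiv d dB)
    (Matrix.fromBlocks (f i) 0 0 (g i)), fun i => reindex_mem_unitaryGroup
      (Matrix.fromBlocks_diagonal_mem_unitaryGroup_s7 (hf i) (hg i)), fun i hi => ?_,
      fun i hi => ?_, ?_⟩
  · intro p q hpq
    obtain ⟨p, rfl⟩ := (prodSumEquiv d dB).surjective p
    obtain ⟨q, rfl⟩ := (prodSumEquiv d dB).surjective q
    refine (reindex_prodSumEquiv_apply _ _ _).trans ?_
    rcases p with p | p <;> rcases q with q | q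
    · exact hfA i hi _ _ fun h => hpq (by simp [prodSumEquiv, h])
    · rfl
    · rfl
    · exact hgA i hi _ _ fun h => hpq (by simp [prodSumEquiv, h])
  · intro p q hpq
    obtain ⟨p, rfl⟩ := (prodSumEquiv d dB).surjective p
    obtain ⟨q, rfl⟩ := (prodSumEquiv d dB).surjective q
    refine (reindex_prodSumEquiv_apply _ _ _).trans ?_
    rcases p with p | p <;> rcases q with q | q
    · exact hfB i hi _ _ fun h => hpq (by simp [prodSumEquiv, h])
    · rfl
    · rfl
    · exact hgB i hi _ _ fun h => hpq (by simp [prodSumEquiv, h])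
  · rw [← ofFn_prod_fromBlocks, map_list_prod, List.map_ofFn]
    rfl

theorem ctrlBcb_reindex_fromBlocks_diagonal (a b c e : Fin d × Fin dB → ℂ) :
    CtrlBcb (Matrix.reindexAlgEquiv ℂ ℂ (prodSumEquiv d dB)
      (Matrix.fromBlocks (Matrix.diagonal a) (-Matrix.diagonal b)
        (Matrix.diagonal c) (Matrix.diagonal e))) := by
  intro p q hpq
  obtain ⟨p, rfl⟩ := (prodSumEquiv d dB).surjective p
  obtain ⟨q, rfl⟩ := (prodSumEquiv d dB).surjective q
  rw [reindex_prodSumEquiv_apply]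
  have hne : ∀ {p q : Fin d × Fin dB}, p.2 ≠ q.2 → p ≠ q := fun h h' => h (congrArg Prod.snd h')
  rcases p with p | p <;> rcases q with q | q <;>
    simp [Matrix.diagonal_apply_ne _ (hne (p := p) (q := q) hpq)]

theorem hasSandwichForm_add_self (hm : Odd m)
    (h : ∀ U ∈ Matrix.unitaryGroup (Fin d × Fin dB) ℂ, HasSandwichForm m U)
    {U : Matrix (Fin (d + d) × Fin dB) (Fin (d + d) × Fin dB) ℂ}
    (hU : U ∈ Matrix.unitaryGroup (Fin (d + d) × Fin dB) ℂ) :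
    HasSandwichForm (m + 1 + m) U := by
  set φ := Matrix.reindexAlgEquiv ℂ ℂ (prodSumEquiv d dB)
  obtain ⟨U, rfl⟩ := φ.surjective U
  have hU' : U ∈ Matrix.unitaryGroup ((Fin d × Fin dB) ⊕ (Fin d × Fin dB)) ℂ := by
    rw [Matrix.mem_unitaryGroup_iff] at *
    apply φ.injective
    rw [map_mul, map_one, ← hU]
    rfl
  obtain ⟨V₁, hV₁, V₂, hV₂, W₁, hW₁, W₂, hW₂, c, s, hcs, rfl⟩ :=
    Matrix.exists_cosine_sine_decomposition_s7 hU'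
  rw [map_mul, map_mul]
  exact (((h _ hV₁).directSum (h _ hV₂)).mul_ctrlBcb hm
    (reindex_mem_unitaryGroup (Matrix.cosine_sine_mem_unitaryGroup hcs))
    (ctrlBcb_reindex_fromBlocks_diagonal _ _ _ _)).mul hm.add_one
    ((h _ hW₁).directSum (h _ hW₂))

theorem hasSandwichForm_one {U : Matrix (Fin 1 × Fin dB) (Fin 1 × Fin dB) ℂ}
    (hU : U ∈ Matrix.unitaryGroup (Fin 1 × Fin dB) ℂ) : HasSandwichForm 1 U :=
  ⟨fun _ => U, fun _ => hU, fun _ _ _ _ hpq => (hpq (Subsingleton.elim _ _)).elim,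
    fun i hi => by simp at hi, by simp⟩

end Sandwich

/-- If every unitary on a `d × d_B` system with odd `d ≥ 3` has a `(2d − 1)`-sandwich form,
then every unitary on a `d_A × d_B` system with even `d_A ≥ 2` has a
`(2 d_A − 1)`-sandwich form. -/
theorem sandwich_form_even_of_odd
    (hyp : ∀ d : ℕ, Odd d → 3 ≤ d → ∀ dB : ℕ, 1 ≤ dB →
      ∀ U : Matrix (Fin d × Fin dB) (Fin d × Fin dB) ℂ,
        U ∈ Matrix.unitaryGroup (Fin d × Fin dB) ℂ → HasSandwichForm (2 * d - 1) U) :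
    ∀ dA : ℕ, Even dA → 2 ≤ dA → ∀ dB : ℕ, 1 ≤ dB →
      ∀ U : Matrix (Fin dA × Fin dB) (Fin dA × Fin dB) ℂ,
        U ∈ Matrix.unitaryGroup (Fin dA × Fin dB) ℂ → HasSandwichForm (2 * dA - 1) U := by
  suffices h : ∀ d : ℕ, 1 ≤ d → ∀ dB : ℕ, 1 ≤ dB →
      ∀ U : Matrix (Fin d × Fin dB) (Fin d × Fin dB) ℂ,
        U ∈ Matrix.unitaryGroup (Fin d × Fin dB) ℂ → HasSandwichForm (2 * d - 1) U from
    fun dA _ hdA => h dA (by omega)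
  intro d
  induction d using Nat.strong_induction_on with
  | _ d ih =>
    intro hd dB hdB U hU
    rcases Nat.even_or_odd d with ⟨k, rfl⟩ | hodd
    · have h := hasSandwichForm_add_self (m := 2 * k - 1) ⟨k - 1, by omega⟩
        (ih k (by omega) (by omega) dB hdB) hU
      rwa [show 2 * k - 1 + 1 + (2 * k - 1) = 2 * (k + k) - 1 by omega] at h
    · rcases hd.eq_or_lt with rfl | hd
      · exact hasSandwichForm_one hU
      · exact hyp d hodd (by obtain ⟨k, rfl⟩ := hodd; omega) dB hdB U hU
end

section
/- Let d_A ≥ 2 and d_B ≥ 2. Every unitary on the d_A × d_B system is the product of three unitaries W_1 W_2 W_3, each of which is a block-controlled unitary (BCU) from the A side or from the B side. -/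
open Matrix Kronecker BigOperators

/-- `W` is a block-controlled unitary (BCU) from the A side: up to local unitaries,
it is block diagonal w.r.t. a nontrivial splitting of the A space into a direct sum. -/
def IsBCUA {dA dB : ℕ} (W : Matrix (Fin dA × Fin dB) (Fin dA × Fin dB) ℂ) : Prop :=
  ∃ (XA YA : Matrix (Fin dA) (Fin dA) ℂ) (XB YB : Matrix (Fin dB) (Fin dB) ℂ)
    (S : Finset (Fin dA)),
    XA ∈ Matrix.unitaryGroup (Fin dA) ℂ ∧ YA ∈ Matrix.unitaryGroup (Fin dA) ℂ ∧
    XB ∈ Matrix.unitaryGroup (Fin dB) ℂ ∧ YB ∈ Matrix.unitaryGroup (Fin dB) ℂ ∧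
    S.Nonempty ∧ Sᶜ.Nonempty ∧
    ∀ p q : Fin dA × Fin dB,
      ((p.1 ∈ S ∧ q.1 ∉ S) ∨ (p.1 ∉ S ∧ q.1 ∈ S)) →
      ((XA ⊗ₖ XB) * W * (YA ⊗ₖ YB)) p q = 0

/-- `W` is a block-controlled unitary (BCU) from the B side. -/
def IsBCUB {dA dB : ℕ} (W : Matrix (Fin dA × Fin dB) (Fin dA × Fin dB) ℂ) : Prop :=
  ∃ (XA YA : Matrix (Fin dA) (Fin dA) ℂ) (XB YB : Matrix (Fin dB) (Fin dB) ℂ)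
    (S : Finset (Fin dB)),
    XA ∈ Matrix.unitaryGroup (Fin dA) ℂ ∧ YA ∈ Matrix.unitaryGroup (Fin dA) ℂ ∧
    XB ∈ Matrix.unitaryGroup (Fin dB) ℂ ∧ YB ∈ Matrix.unitaryGroup (Fin dB) ℂ ∧
    S.Nonempty ∧ Sᶜ.Nonempty ∧
    ∀ p q : Fin dA × Fin dB,
      ((p.2 ∈ S ∧ q.2 ∉ S) ∨ (p.2 ∉ S ∧ q.2 ∈ S)) →
      ((XA ⊗ₖ XB) * W * (YA ⊗ₖ YB)) p q = 0

/-- A square matrix with pairwise orthogonal columns is a unitary times a nonnegative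
diagonal matrix. -/
theorem exists_unitary_of_orthogonal_columns {ι : Type*} [Fintype ι] [DecidableEq ι]
    (A : Matrix ι ι ℂ) (hA : ∀ i j, i ≠ j → (Aᴴ * A) i j = 0) :
    ∃ V ∈ Matrix.unitaryGroup ι ℂ, ∃ c : ι → ℝ, (∀ j, 0 ≤ c j) ∧
      (∀ j, ((c j : ℂ)) ^ 2 = (Aᴴ * A) j j) ∧ ∀ i j, A i j = V i j * c j := by
  let f : ι → EuclideanSpace ℂ ι := fun j => WithLp.toLp 2 (fun i => A i j)
  have hf : ∀ i j, inner ℂ (f i) (f j) = (Aᴴ * A) i j := fun i j => by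
    simp [f, PiLp.inner_apply, Matrix.mul_apply, mul_comm]
  let g : ι → EuclideanSpace ℂ ι := fun j => ((‖f j‖⁻¹ : ℝ) : ℂ) • f j
  have hg : Orthonormal ℂ (({j | f j ≠ 0} : Set ι).domRestrict g) := by
    refine ⟨fun j => ?_, fun i j hij => ?_⟩
    · have hj : ‖f j‖ ≠ 0 := norm_ne_zero_iff.mpr j.2
      simp [g, Set.domRestrict, norm_smul, hj]
    · have : inner ℂ (f i) (f j) = 0 := by
        rw [hf]; exact hA _ _ fun h => hij (Subtype.ext h)
      simp [g, Set.domRestrict, inner_smul_left, inner_smul_right, this]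
  obtain ⟨b, hb⟩ := hg.exists_orthonormalBasis_extension_of_card_eq (by simp)
  refine ⟨Matrix.of fun i j => b j i, ?_, fun j => ‖f j‖, fun j => norm_nonneg _,
    fun j => ?_, fun i j => ?_⟩
  · rw [Matrix.mem_unitaryGroup_iff']
    ext i j
    have := b.inner_eq_ite i j
    rw [PiLp.inner_apply] at this
    simpa [Matrix.mul_apply, Matrix.one_apply, mul_comm] using this
  · rw [← hf, inner_self_eq_norm_sq_to_K]
    rfl
  · by_cases hj : f j = 0
    · have : A i j = 0 := congrArg (fun v : EuclideanSpace ℂ ι => v i) hj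
      simp [hj, this]
    · have h0 : (‖f j‖ : ℂ) ≠ 0 := by exact_mod_cast norm_ne_zero_iff.mpr hj
      have : b j i = (‖f j‖ : ℂ)⁻¹ * A i j := by
        rw [hb j hj]
        simp [g, f]
      simp only [Matrix.of_apply, this]
      field_simp

/-- Every unit vector is a column of a unitary matrix. -/
theorem exists_unitary_column {α : Type*} [Fintype α] [DecidableEq α] (a₀ : α) (v : α → ℂ)
    (hv : ∑ j, star (v j) * v j = 1) :
    ∃ G ∈ Matrix.unitaryGroup α ℂ, ∀ j, G j a₀ = v j := by
  obtain ⟨G, hG, c, hc, hc2, hAc⟩ := exists_unitary_of_orthogonal_columns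
    (Matrix.of fun j j' => if j' = a₀ then v j else 0) (by
      intro i j hij
      rw [Matrix.mul_apply]
      refine Finset.sum_eq_zero fun k _ => ?_
      by_cases hi : i = a₀
      · have : j ≠ a₀ := fun h => hij (hi.trans h.symm)
        simp [this]
      · simp [hi])
  have h1 : (c a₀ : ℂ) ^ 2 = 1 := by
    rw [hc2, ← hv]
    simp [Matrix.mul_apply]
  have h2 : c a₀ = 1 := by
    have : c a₀ ^ 2 = 1 := by exact_mod_cast h1
    nlinarith [hc a₀]
  refine ⟨G, hG, fun j => ?_⟩
  simpa [h2] using (hAc j a₀).symm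

/-- Assembling unitaries on the two halves of a splitting of the index set. -/
theorem exists_unitary_of_blocks {ι : Type*} [Fintype ι] [DecidableEq ι] (P : ι → Prop)
    [DecidablePred P] {V : Matrix {i // P i} {i // P i} ℂ} (hV : V ∈ Matrix.unitaryGroup _ ℂ)
    {V' : Matrix {i // ¬ P i} {i // ¬ P i} ℂ} (hV' : V' ∈ Matrix.unitaryGroup _ ℂ) :
    ∃ W ∈ Matrix.unitaryGroup ι ℂ,
      (∀ i j (hi : P i) (hj : P j), W i j = V ⟨i, hi⟩ ⟨j, hj⟩) ∧
      (∀ i j (hi : ¬ P i) (hj : ¬ P j), W i j = V' ⟨i, hi⟩ ⟨j, hj⟩) ∧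
      ∀ i j, (P i ∧ ¬ P j) ∨ (¬ P i ∧ P j) → W i j = 0 := by
  let e := (Equiv.sumCompl P).symm
  refine ⟨(Matrix.fromBlocks V 0 0 V').submatrix e e, ?_, ?_, ?_, ?_⟩
  · rw [Matrix.mem_unitaryGroup_iff'] at *
    rw [Matrix.star_eq_conjTranspose] at *
    rw [Matrix.conjTranspose_submatrix, Matrix.submatrix_mul_equiv,
      Matrix.fromBlocks_conjTranspose, Matrix.fromBlocks_multiply]
    simp [hV, hV']
  · intro i j hi hj
    simp [e, Equiv.sumCompl_symm_apply_of_pos, hi, hj]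
  · intro i j hi hj
    simp [e, Equiv.sumCompl_symm_apply_of_neg, hi, hj]
  · rintro i j (⟨hi, hj⟩ | ⟨hi, hj⟩) <;>
      simp [e, Equiv.sumCompl_symm_apply_of_neg, Equiv.sumCompl_symm_apply_of_pos, hi, hj]

theorem blockDiagonal_mem_unitaryGroup {α β : Type*} [Fintype α] [DecidableEq α] [Fintype β]
    [DecidableEq β] {G : β → Matrix α α ℂ} (hG : ∀ k, G k ∈ Matrix.unitaryGroup α ℂ) :
    Matrix.blockDiagonal G ∈ Matrix.unitaryGroup (α × β) ℂ := by
  simp only [Matrix.mem_unitaryGroup_iff', Matrix.star_eq_conjTranspose] at *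
  rw [Matrix.blockDiagonal_conjTranspose, ← Matrix.blockDiagonal_mul]
  simp only [hG]
  exact Matrix.blockDiagonal_one

/-- The columns of a square matrix become pairwise orthogonal after multiplying by a suitable
unitary on the right. -/
theorem exists_unitary_orthogonal_columns_mul {β : Type*} [Fintype β] [DecidableEq β]
    (M : Matrix β β ℂ) :
    ∃ R ∈ Matrix.unitaryGroup β ℂ, ∀ k l, k ≠ l → ((M * R)ᴴ * (M * R)) k l = 0 := by
  have hM : (Mᴴ * M).IsHermitian := Matrix.isHermitian_conjTranspose_mul_self M
  refine ⟨hM.eigenvectorUnitary, hM.eigenvectorUnitary.2, fun k l hkl => ?_⟩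
  have h := hM.conjStarAlgAut_star_eigenvectorUnitary
  rw [Unitary.conjStarAlgAut_star_apply] at h
  rw [Matrix.conjTranspose_mul]
  simp only [← Matrix.mul_assoc] at h ⊢
  rw [Matrix.star_eq_conjTranspose] at h
  rw [h, Matrix.diagonal_apply_ne _ hkl]

/-- A unitary whose columns over `a₀` are standard basis vectors is block diagonal with
respect to `a₀`. -/
theorem unitary_apply_eq_zero_of_columns {α β : Type*} [Fintype α] [DecidableEq α] [Fintype β]
    [DecidableEq β] {a₀ : α} {T : Matrix (α × β) (α × β) ℂ}
    (hT : T ∈ Matrix.unitaryGroup (α × β) ℂ)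
    (hcol : ∀ p k, T p (a₀, k) = (1 : Matrix (α × β) (α × β) ℂ) p (a₀, k)) (p q : α × β)
    (hpq : (p.1 = a₀ ∧ q.1 ≠ a₀) ∨ (p.1 ≠ a₀ ∧ q.1 = a₀)) : T p q = 0 := by
  obtain ⟨a, k⟩ := p
  obtain ⟨b, l⟩ := q
  rcases hpq with ⟨rfl, h⟩ | ⟨h, rfl⟩
  · have h1 := congrFun (congrFun (Matrix.mem_unitaryGroup_iff'.mp hT) (a, k)) (b, l)
    rw [Matrix.mul_apply, Matrix.one_apply_ne (by simpa using fun h' => absurd h'.symm h)] at h1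
    simpa [Matrix.star_apply, hcol, Matrix.one_apply] using h1
  · rw [hcol, Matrix.one_apply_ne (by simpa using fun h' => absurd h' h)]

/-- The cosine-sine decomposition of the columns of `U` over `a₀`: up to a unitary on the second
factor they are the columns of a unitary block diagonal in the first factor times a
unitary block diagonal in the second one. -/
theorem exists_cosine_sine {α β : Type*} [Fintype α] [DecidableEq α] [Fintype β]
    [DecidableEq β] {a₀ a₁ : α} (ha : a₁ ≠ a₀) {U : Matrix (α × β) (α × β) ℂ}
    (hU : U ∈ Matrix.unitaryGroup (α × β) ℂ) :
    ∃ R ∈ Matrix.unitaryGroup β ℂ, ∃ W₁ ∈ Matrix.unitaryGroup (α × β) ℂ,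
      ∃ W₂ ∈ Matrix.unitaryGroup (α × β) ℂ,
      (∀ p q, (p.1 = a₀ ∧ q.1 ≠ a₀) ∨ (p.1 ≠ a₀ ∧ q.1 = a₀) → W₁ p q = 0) ∧
      (∀ p q, p.2 ≠ q.2 → W₂ p q = 0) ∧
      ∀ p k, (W₁ * W₂) p (a₀, k) = (U * ((1 : Matrix α α ℂ) ⊗ₖ R)) p (a₀, k) := by
  obtain ⟨R, hR, hMR⟩ := exists_unitary_orthogonal_columns_mul
    (Matrix.of fun k l => U (a₀, k) (a₀, l))
  set X := U * ((1 : Matrix α α ℂ) ⊗ₖ R) with hX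
  have hXu : X ∈ Matrix.unitaryGroup (α × β) ℂ :=
    mul_mem hU (Matrix.kronecker_mem_unitary (one_mem _) hR)
  have hX0 : ∀ k l, X (a₀, k) (a₀, l) = ((Matrix.of fun k l => U (a₀, k) (a₀, l)) * R) k l := by
    intro k l
    simp [hX, Matrix.mul_apply, Fintype.sum_prod_type, Matrix.one_apply]
  let P : α × β → Prop := fun p => p.1 = a₀
  let inP : β → β → ℂ := fun k l => ∑ i : {i // P i}, star (X i (a₀, k)) * X i (a₀, l)
  let outP : β → β → ℂ := fun k l => ∑ i : {i // ¬ P i}, star (X i (a₀, k)) * X i (a₀, l)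
  have hsum : ∀ k l, inP k l + outP k l = if k = l then 1 else 0 := by
    intro k l
    have h := congrFun (congrFun (Matrix.mem_unitaryGroup_iff'.mp hXu) (a₀, k)) (a₀, l)
    simp only [Matrix.mul_apply, Matrix.star_apply, Matrix.one_apply, Prod.mk.injEq,
      true_and] at h
    rw [← h]
    exact Fintype.sum_subtype_add_sum_subtype P fun i => star (X i (a₀, k)) * X i (a₀, l)
  have hin : ∀ k l, k ≠ l → inP k l = 0 := by
    intro k l hkl
    rw [← hMR k l hkl, Matrix.mul_apply]
    let e : β ≃ {i : α × β // P i} :=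
      { toFun := fun k => ⟨(a₀, k), rfl⟩
        invFun := fun i => i.1.2
        left_inv := fun _ => rfl
        right_inv := fun i => Subtype.ext (Prod.ext i.2.symm rfl) }
    refine (Equiv.sum_comp e _).symm.trans (Finset.sum_congr rfl fun i _ => ?_)
    rw [Matrix.conjTranspose_apply, ← hX0, ← hX0]
    rfl
  have hout : ∀ k l, k ≠ l → outP k l = 0 := by
    intro k l hkl
    simpa [hin k l hkl, hkl] using hsum k l
  obtain ⟨V, hV, c, -, hc, hVc⟩ := exists_unitary_of_orthogonal_columns
    (Matrix.of fun i q : {i // P i} => X i (a₀, q.1.2)) (by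
      intro i j hij
      exact hin _ _ fun h => hij (Subtype.ext (Prod.ext (i.2.trans j.2.symm) h)))
  obtain ⟨V', hV', s, -, hs, hVs⟩ := exists_unitary_of_orthogonal_columns
    (Matrix.of fun i q : {i // ¬ P i} => if q.1.1 = a₁ then X i (a₀, q.1.2) else 0) (by
      intro i j hij
      by_cases h1 : i.1.1 = a₁
      · by_cases h2 : j.1.1 = a₁
        · have := hout _ _ fun h => hij (Subtype.ext (Prod.ext (h1.trans h2.symm) h))
          simpa [Matrix.mul_apply, outP, h1, h2] using this
        · simp [Matrix.mul_apply, h2]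
      · simp [Matrix.mul_apply, h1])
  let c' : β → ℝ := fun k => c ⟨(a₀, k), rfl⟩
  let s' : β → ℝ := fun k => s ⟨(a₁, k), ha⟩
  have hcs : ∀ k, (c' k : ℂ) ^ 2 + (s' k : ℂ) ^ 2 = 1 := by
    intro k
    have h1 : (c' k : ℂ) ^ 2 = inP k k := hc _
    have h2 : (s' k : ℂ) ^ 2 = outP k k := by
      refine (hs _).trans ?_
      simp [Matrix.mul_apply, outP]
    rw [h1, h2, hsum, if_pos rfl]
  have hG : ∀ k, ∃ G ∈ Matrix.unitaryGroup α ℂ,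
      ∀ j, G j a₀ = (if j = a₀ then (c' k : ℂ) else 0) + if j = a₁ then (s' k : ℂ) else 0 := by
    refine fun k => exists_unitary_column a₀ _ ?_
    rw [← hcs k, ← Finset.sum_subset (Finset.subset_univ {a₀, a₁}), Finset.sum_pair ha.symm]
    · simp [ha, ha.symm, sq]
    · intro j _ hj
      simp only [Finset.mem_insert, Finset.mem_singleton, not_or] at hj
      simp [hj.1, hj.2]
  choose G hGu hG using hG
  obtain ⟨W₁, hW₁, hpos, hneg, hoff⟩ := exists_unitary_of_blocks P hV hV'
  refine ⟨R, hR, W₁, hW₁, Matrix.blockDiagonal G, blockDiagonal_mem_unitaryGroup hGu, hoff,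
    fun p q hpq => Matrix.blockDiagonal_apply_ne G p.1 q.1 hpq, fun p k => ?_⟩
  have hmul : (W₁ * Matrix.blockDiagonal G) p (a₀, k) =
      W₁ p (a₀, k) * c' k + W₁ p (a₁, k) * s' k := by
    simp [Matrix.mul_apply, Fintype.sum_prod_type, Matrix.blockDiagonal_apply, hG, mul_add,
      Finset.sum_add_distrib]
  rw [hmul]
  by_cases hp : P p
  · rw [hoff p (a₁, k) (Or.inl ⟨hp, ha⟩), hpos p (a₀, k) hp rfl, zero_mul, add_zero]
    exact (hVc ⟨p, hp⟩ ⟨(a₀, k), rfl⟩).symm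
  · rw [hoff p (a₀, k) (Or.inr ⟨hp, rfl⟩), hneg p (a₁, k) hp ha, zero_mul, zero_add]
    simpa using (hVs ⟨p, hp⟩ ⟨(a₁, k), ha⟩).symm

/-- Every bipartite unitary is the product of three block-controlled unitaries. -/
theorem unitary_three_BCU (dA dB : ℕ) (hdA : 2 ≤ dA) (hdB : 2 ≤ dB)
    (U : Matrix (Fin dA × Fin dB) (Fin dA × Fin dB) ℂ)
    (hU : U ∈ Matrix.unitaryGroup (Fin dA × Fin dB) ℂ) :
    ∃ W₁ W₂ W₃ : Matrix (Fin dA × Fin dB) (Fin dA × Fin dB) ℂ,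
      W₁ ∈ Matrix.unitaryGroup (Fin dA × Fin dB) ℂ ∧
      W₂ ∈ Matrix.unitaryGroup (Fin dA × Fin dB) ℂ ∧
      W₃ ∈ Matrix.unitaryGroup (Fin dA × Fin dB) ℂ ∧
      (IsBCUA W₁ ∨ IsBCUB W₁) ∧ (IsBCUA W₂ ∨ IsBCUB W₂) ∧ (IsBCUA W₃ ∨ IsBCUB W₃) ∧
      U = W₁ * W₂ * W₃ := by
  let a₀ : Fin dA := ⟨0, by omega⟩
  let a₁ : Fin dA := ⟨1, by omega⟩
  let b₀ : Fin dB := ⟨0, by omega⟩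
  let b₁ : Fin dB := ⟨1, by omega⟩
  have ha : a₁ ≠ a₀ := by simp [a₀, a₁]
  have hb : b₁ ≠ b₀ := by simp [b₀, b₁]
  obtain ⟨R, hR, W₁, hW₁, W₂, hW₂, hb₁, hb₂, hcol⟩ := exists_cosine_sine ha hU
  have hW := mul_mem hW₁ hW₂
  have hW₃ : star (W₁ * W₂) * U ∈ Matrix.unitaryGroup (Fin dA × Fin dB) ℂ :=
    mul_mem (Unitary.star_mem hW) hU
  refine ⟨W₁, W₂, star (W₁ * W₂) * U, hW₁, hW₂, hW₃, Or.inl ?_, Or.inr ?_, Or.inl ?_, ?_⟩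
  · refine ⟨1, 1, 1, 1, {a₀}, one_mem _, one_mem _, one_mem _, one_mem _,
      Finset.singleton_nonempty _, ⟨a₁, by simpa using ha⟩, fun p q hpq => ?_⟩
    simp only [Matrix.one_kronecker_one, Matrix.one_mul, Matrix.mul_one]
    exact hb₁ p q (by simpa using hpq)
  · refine ⟨1, 1, 1, 1, {b₀}, one_mem _, one_mem _, one_mem _, one_mem _,
      Finset.singleton_nonempty _, ⟨b₁, by simpa using hb⟩, fun p q hpq => ?_⟩
    simp only [Matrix.one_kronecker_one, Matrix.one_mul, Matrix.mul_one]
    refine hb₂ p q fun h => ?_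
    rw [h] at hpq
    tauto
  · refine ⟨1, 1, 1, R, {a₀}, one_mem _, one_mem _, one_mem _, hR,
      Finset.singleton_nonempty _, ⟨a₁, by simpa using ha⟩, fun p q hpq => ?_⟩
    rw [Matrix.one_kronecker_one, Matrix.one_mul]
    refine unitary_apply_eq_zero_of_columns (a₀ := a₀)
      (mul_mem hW₃ (Matrix.kronecker_mem_unitary (one_mem _) hR)) (fun p k => ?_) p q
      (by simpa using hpq)
    rw [← Matrix.mem_unitaryGroup_iff'.mp hW, Matrix.mul_assoc, Matrix.mul_apply,
      Matrix.mul_apply]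
    simp only [hcol]
  · rw [← Matrix.mul_assoc, Matrix.mem_unitaryGroup_iff.mp hW, Matrix.one_mul]
end

section
/- Let V be a complex matrix indexed by Fin d_A × Fin d_B, viewed as a d_A × d_A array of d_B × d_B blocks V_{j,k}. Then V is not absolutely singular if and only if there exists a permutation σ of Fin d_A such that the block V_{j,σ(j)} is nonzero for every j ∈ Fin d_A. -/
open Matrix BigOperators

/-- A bipartite matrix, viewed as a `d_A × d_A` array of `d_B × d_B` blocks, is absolutely
singular if there are index sets `S`, `T` with `|S| + |T| > d_A` such that every block
`V_{j,k}` with `j ∈ S`, `k ∈ T` is zero. -/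
def AbsolutelySingular {dA dB : ℕ}
    (V : Matrix (Fin dA × Fin dB) (Fin dA × Fin dB) ℂ) : Prop :=
  ∃ S T : Finset (Fin dA), dA < S.card + T.card ∧
    ∀ j ∈ S, ∀ k ∈ T, ∀ l m : Fin dB, V (j, l) (k, m) = 0

/-- The Frobenius-König form of Hall's marriage theorem: a relation on a finite type contains the
graph of a permutation iff it has no empty rectangle `S × T` with `|S| + |T|` exceeding the
cardinality of the type. -/
theorem exists_perm_forall_rel_iff {α : Type*} [Fintype α] (r : α → α → Prop) :
    (∃ σ : Equiv.Perm α, ∀ a, r a (σ a)) ↔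
      ∀ S T : Finset α, (∀ a ∈ S, ∀ b ∈ T, ¬ r a b) → S.card + T.card ≤ Fintype.card α := by
  classical
  constructor
  · rintro ⟨σ, hσ⟩ S T h
    have hdisj : Disjoint (S.map σ.toEmbedding) T := by
      rw [Finset.disjoint_left]
      intro b hb hbT
      obtain ⟨a, ha, rfl⟩ := Finset.mem_map.1 hb
      exact h a ha _ hbT (hσ a)
    rw [← Finset.card_map σ.toEmbedding, ← Finset.card_union_of_disjoint hdisj]
    exact Finset.card_le_univ _
  · intro h
    obtain ⟨f, hf, hr⟩ := (Fintype.all_card_le_filter_rel_iff_exists_injective r).1 fun S => by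
      have hS := h S ({b | ∃ a ∈ S, r a b} : Finset α)ᶜ fun a ha b hb hab => by
        simp only [Finset.mem_compl, Finset.mem_filter_univ] at hb
        exact hb ⟨a, ha, hab⟩
      have := Finset.card_add_card_compl ({b | ∃ a ∈ S, r a b} : Finset α)
      omega
    exact ⟨Equiv.ofBijective f (Finite.injective_iff_bijective.1 hf), hr⟩

/-- `V` is not absolutely singular iff some permutation `σ` of the block rows picks a
nonzero block `V_{j, σ j}` in every big row `j` (a form of Hall's marriage theorem). -/
theorem not_absolutelySingular_iff (dA dB : ℕ)
    (V : Matrix (Fin dA × Fin dB) (Fin dA × Fin dB) ℂ) :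
    ¬ AbsolutelySingular V ↔
      ∃ σ : Equiv.Perm (Fin dA), ∀ j : Fin dA, ∃ l m : Fin dB, V (j, l) (σ j, m) ≠ 0 := by
  rw [exists_perm_forall_rel_iff fun j k => ∃ l m : Fin dB, V (j, l) (k, m) ≠ 0]
  simp only [AbsolutelySingular, not_exists, not_and', not_lt, not_not, Fintype.card_fin]
end

section
/- Let U be a permutation matrix indexed by Fin d_A × Fin d_B (d_A, d_B ≥ 1). Then U = U_1 U_2 U_3 where U_1 and U_3 are controlled-permutation matrices from the A side in the computational basis and U_2 is a controlled-permutation matrix from the B side in the computational basis. -/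
open Matrix BigOperators

/-- A permutation matrix: a 0–1 matrix with exactly one 1 in each row and each column. -/
def IsPermMatrix {n : Type*} (M : Matrix n n ℂ) : Prop :=
  (∀ i j, M i j = 0 ∨ M i j = 1) ∧ (∀ i, ∃! j, M i j = 1) ∧ (∀ j, ∃! i, M i j = 1)

/-- A controlled-permutation matrix from the A side in the computational basis:
`∑_j |j⟩⟨j| ⊗ P_j` with each `P_j` a permutation matrix. -/
def CtrlPermA {dA dB : ℕ} (U : Matrix (Fin dA × Fin dB) (Fin dA × Fin dB) ℂ) : Prop :=
  ∃ P : Fin dA → Matrix (Fin dB) (Fin dB) ℂ, (∀ j, IsPermMatrix (P j)) ∧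
    ∀ p q : Fin dA × Fin dB, U p q = if p.1 = q.1 then P p.1 p.2 q.2 else 0

/-- A controlled-permutation matrix from the B side in the computational basis:
`∑_k Q_k ⊗ |k⟩⟨k|` with each `Q_k` a permutation matrix. -/
def CtrlPermB {dA dB : ℕ} (U : Matrix (Fin dA × Fin dB) (Fin dA × Fin dB) ℂ) : Prop :=
  ∃ Q : Fin dB → Matrix (Fin dA) (Fin dA) ℂ, (∀ k, IsPermMatrix (Q k)) ∧
    ∀ p q : Fin dA × Fin dB, U p q = if p.2 = q.2 then Q p.2 p.1 q.1 else 0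

open Finset in
/-- In a nonempty regular bipartite multigraph with edge set `S` and end maps `s`, `t`,
there is a perfect matching. -/
theorem exists_perfect_matching {E A : Type*} [Fintype A] [DecidableEq E] [DecidableEq A]
    (s t : E → A) (n : ℕ) (S : Finset E)
    (hs : ∀ a, #{e ∈ S | s e = a} = n + 1) (ht : ∀ a, #{e ∈ S | t e = a} = n + 1) :
    ∃ m : A → E, (∀ a, m a ∈ S) ∧ (∀ a, s (m a) = a) ∧ Function.Bijective (t ∘ m) := by
  have hcount : ∀ (u : E → A), (∀ a, #{e ∈ S | u e = a} = n + 1) → ∀ X : Finset A,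
      #{e ∈ S | u e ∈ X} = #X * (n + 1) := by
    intro u hu X
    rw [card_eq_sum_card_fiberwise (f := u) (t := X) (by intro e he; simp_all)]
    rw [← smul_eq_mul, ← sum_const]
    refine sum_congr rfl fun a ha => ?_
    rw [← hu a, filter_filter]
    congr 1
    ext e
    simp only [mem_filter]
    constructor
    · tauto
    · rintro ⟨h, rfl⟩
      tauto
  obtain ⟨f, hf, hfm⟩ := (Finset.all_card_le_biUnion_card_iff_exists_injective
    (fun a => image t {e ∈ S | s e = a})).1 (by
      intro X
      refine Nat.le_of_mul_le_mul_right ?_ n.succ_pos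
      rw [Nat.succ_eq_add_one, ← hcount s hs, ← hcount t ht]
      refine card_le_card fun e he => ?_
      simp only [mem_filter, mem_biUnion, mem_image] at he ⊢
      exact ⟨he.1, s e, he.2, e, ⟨he.1, rfl⟩, rfl⟩)
  simp only [mem_image, mem_filter] at hfm
  choose m hm hmf using hfm
  have htm : t ∘ m = f := funext hmf
  exact ⟨m, fun a => (hm a).1, fun a => (hm a).2, htm ▸ Finite.injective_iff_bijective.1 hf⟩

open Finset in
/-- König's edge colouring theorem for an `n`-regular bipartite multigraph with edge set `S`
and end maps `s`, `t`. -/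
theorem exists_edge_coloring {E A : Type*} [Fintype A] [DecidableEq E] [DecidableEq A]
    (s t : E → A) (n : ℕ) (S : Finset E)
    (hs : ∀ a, #{e ∈ S | s e = a} = n) (ht : ∀ a, #{e ∈ S | t e = a} = n) :
    ∃ c : E → ℕ, (∀ e ∈ S, c e < n) ∧ Set.InjOn (fun e => (s e, c e)) S ∧
      Set.InjOn (fun e => (t e, c e)) S := by
  induction n generalizing S with
  | zero =>
    have hS : S = ∅ := eq_empty_of_forall_notMem fun e he => by
      have := card_eq_zero.1 (hs (s e))
      exact notMem_empty e (this ▸ mem_filter.2 ⟨he, rfl⟩)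
    exact ⟨fun _ => 0, by simp [hS], by simp [hS], by simp [hS]⟩
  | succ n ih =>
    obtain ⟨m, hmS, hsm, htm⟩ := exists_perfect_matching s t n S hs ht
    have hcard : ∀ u : E → A, Function.Bijective (u ∘ m) → (∀ a, #{e ∈ S | u e = a} = n + 1) →
        ∀ a, #{e ∈ S \ univ.image m | u e = a} = n := by
      intro u hu hus a
      obtain ⟨b, rfl⟩ := hu.2 a
      have : ({e ∈ S \ univ.image m | u e = (u ∘ m) b} : Finset E)
          = ({e ∈ S | u e = (u ∘ m) b} : Finset E).erase (m b) := by
        ext e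
        simp only [mem_filter, mem_sdiff, mem_image, mem_univ, true_and, mem_erase]
        constructor
        · rintro ⟨⟨h1, h2⟩, h3⟩
          exact ⟨fun h => h2 ⟨b, h.symm⟩, h1, h3⟩
        · rintro ⟨h1, h2, h3⟩
          refine ⟨⟨h2, ?_⟩, h3⟩
          rintro ⟨b', rfl⟩
          exact h1 (congrArg m (hu.1 h3))
      rw [this, card_erase_of_mem (by simp [hmS]), hus, Nat.add_sub_cancel]
    have hsb : Function.Bijective (s ∘ m) := by
      have : s ∘ m = id := funext hsm
      exact this ▸ Function.bijective_id
    obtain ⟨c, hc, hcs, hct⟩ := ih _ (hcard s hsb hs) (hcard t htm ht)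
    have hinj : ∀ u : E → A, Function.Bijective (u ∘ m) →
        Set.InjOn (fun e => (u e, c e)) (S \ univ.image m : Finset E) →
        Set.InjOn (fun e => (u e, if e ∈ univ.image m then n else c e)) S := by
      intro u hu hcu e he e' he' h
      simp only [Prod.mk.injEq] at h
      obtain ⟨h1, h2⟩ := h
      by_cases hm : e ∈ univ.image m <;> by_cases hm' : e' ∈ univ.image m
      · obtain ⟨a, -, rfl⟩ := mem_image.1 hm
        obtain ⟨a', -, rfl⟩ := mem_image.1 hm'
        exact congrArg m (hu.1 h1)
      · rw [if_pos hm, if_neg hm'] at h2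
        exact absurd h2 (hc e' (mem_sdiff.2 ⟨he', hm'⟩)).ne'
      · rw [if_neg hm, if_pos hm'] at h2
        exact absurd h2 (hc e (mem_sdiff.2 ⟨he, hm⟩)).ne
      · rw [if_neg hm, if_neg hm'] at h2
        exact hcu (mem_sdiff.2 ⟨he, hm⟩) (mem_sdiff.2 ⟨he', hm'⟩) (Prod.ext h1 h2)
    refine ⟨fun e => if e ∈ univ.image m then n else c e, fun e he => ?_,
      hinj s hsb hcs, hinj t htm hct⟩
    dsimp only
    split_ifs with hm
    · exact n.lt_succ_self
    · exact (hc e (mem_sdiff.2 ⟨he, hm⟩)).trans n.lt_succ_self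

theorem permMatrix_eq_ite {n : Type*} [DecidableEq n] (σ : Equiv.Perm n) (i j : n) :
    σ.permMatrix ℂ i j = if σ i = j then 1 else 0 := by
  simp [Equiv.Perm.permMatrix, PEquiv.toMatrix_apply, eq_comm]

theorem isPermMatrix_permMatrix {n : Type*} [DecidableEq n] (σ : Equiv.Perm n) :
    IsPermMatrix (σ.permMatrix ℂ) := by
  simp only [IsPermMatrix, permMatrix_eq_ite]
  refine ⟨fun i j => ?_, fun i => ⟨σ i, by simp, fun j h => ?_⟩,
    fun j => ⟨σ.symm j, by simp, fun i h => ?_⟩⟩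
  · split_ifs <;> simp
  · simpa [eq_comm] using h
  · simpa [Equiv.eq_symm_apply] using h

theorem IsPermMatrix.exists_eq_permMatrix {n : Type*} [DecidableEq n] {M : Matrix n n ℂ}
    (hM : IsPermMatrix M) : ∃ σ : Equiv.Perm n, M = σ.permMatrix ℂ := by
  obtain ⟨h01, hrow, hcol⟩ := hM
  choose f hf hf' using hrow
  have hbij : Function.Bijective f := by
    refine ⟨fun i i' h => ?_, fun j => ?_⟩
    · exact (hcol (f i)).unique (hf i) (h ▸ hf i')
    · obtain ⟨i, hi, -⟩ := hcol j
      exact ⟨i, (hf' i j hi).symm⟩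
  refine ⟨Equiv.ofBijective f hbij, ?_⟩
  ext i j
  rw [permMatrix_eq_ite, Equiv.ofBijective_apply]
  split_ifs with h
  · exact h ▸ hf i
  · exact (h01 i j).resolve_right fun h1 => h (hf' i j h1).symm

theorem ctrlPermA_permMatrix {dA dB : ℕ} (f : Equiv.Perm (Fin dA × Fin dB))
    (hf : ∀ p, (f p).1 = p.1) : CtrlPermA (f.permMatrix ℂ) := by
  have hbij : ∀ j, Function.Bijective fun k => (f (j, k)).2 := fun j =>
    Finite.injective_iff_bijective.1 fun k k' h =>
      (Prod.mk.inj (f.injective (Prod.ext ((hf (j, k)).trans (hf (j, k')).symm) h))).2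
  refine ⟨fun j => Equiv.Perm.permMatrix ℂ (Equiv.ofBijective _ (hbij j)),
    fun j => isPermMatrix_permMatrix _, fun p q => ?_⟩
  simp only [permMatrix_eq_ite, Equiv.ofBijective_apply, Prod.ext_iff (x := f p), hf]
  split_ifs <;> simp_all

theorem ctrlPermB_permMatrix {dA dB : ℕ} (f : Equiv.Perm (Fin dA × Fin dB))
    (hf : ∀ p, (f p).2 = p.2) : CtrlPermB (f.permMatrix ℂ) := by
  have hbij : ∀ k, Function.Bijective fun j => (f (j, k)).1 := fun k =>
    Finite.injective_iff_bijective.1 fun j j' h =>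
      (Prod.mk.inj (f.injective (Prod.ext h ((hf (j, k)).trans (hf (j', k)).symm)))).1
  refine ⟨fun k => Equiv.Perm.permMatrix ℂ (Equiv.ofBijective _ (hbij k)),
    fun k => isPermMatrix_permMatrix _, fun p q => ?_⟩
  simp only [permMatrix_eq_ite, Equiv.ofBijective_apply, Prod.ext_iff (x := f p), hf]
  split_ifs <;> simp_all

/-- For every permutation `σ` of a grid, the cells can be coloured by the columns so that the cells
of each row, and the cells sent by `σ` into each row, receive every colour exactly once. -/
theorem exists_grid_coloring {dA dB : ℕ} (σ : Equiv.Perm (Fin dA × Fin dB)) :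
    ∃ c : Fin dA × Fin dB → Fin dB, Function.Bijective (fun e => (e.1, c e)) ∧
      Function.Bijective (fun e => ((σ e).1, c e)) := by
  have hfst : ∀ a : Fin dA, (Finset.univ.filter fun e : Fin dA × Fin dB => e.1 = a).card = dB := by
    intro a
    have : (Finset.univ.filter fun e : Fin dA × Fin dB => e.1 = a)
        = Finset.univ.map (Function.Embedding.sectR a (Fin dB)) := by
      ext ⟨x, y⟩
      simp [eq_comm]
    rw [this, Finset.card_map, Finset.card_univ, Fintype.card_fin]
  obtain ⟨c, hc, hs, ht⟩ := exists_edge_coloring (fun e : Fin dA × Fin dB => e.1)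
    (fun e => (σ e).1) dB Finset.univ hfst fun a => by
      exact (Finset.card_equiv σ (by simp)).trans (hfst a)
  refine ⟨fun e => ⟨c e, hc e (Finset.mem_univ e)⟩, Finite.injective_iff_bijective.1 ?_,
    Finite.injective_iff_bijective.1 ?_⟩
  · intro e e' h
    exact hs (Finset.mem_coe.2 (Finset.mem_univ e)) (Finset.mem_coe.2 (Finset.mem_univ e'))
      (by simpa using h)
  · intro e e' h
    exact ht (Finset.mem_coe.2 (Finset.mem_univ e)) (Finset.mem_coe.2 (Finset.mem_univ e'))
      (by simpa using h)

/-- Every bipartite permutation matrix is the product of three controlled-permutation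
matrices, controlled from the A, B and A sides in the computational basis. -/
theorem perm_three_ctrlPerm (dA dB : ℕ) (hdA : 1 ≤ dA) (hdB : 1 ≤ dB)
    (U : Matrix (Fin dA × Fin dB) (Fin dA × Fin dB) ℂ) (hU : IsPermMatrix U) :
    ∃ U₁ U₂ U₃ : Matrix (Fin dA × Fin dB) (Fin dA × Fin dB) ℂ,
      CtrlPermA U₁ ∧ CtrlPermB U₂ ∧ CtrlPermA U₃ ∧ U = U₁ * U₂ * U₃ := by
  obtain ⟨σ, rfl⟩ := hU.exists_eq_permMatrix
  obtain ⟨c, hf, hg⟩ := exists_grid_coloring σ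
  let f : Equiv.Perm (Fin dA × Fin dB) := Equiv.ofBijective _ hf
  let g : Equiv.Perm (Fin dA × Fin dB) := Equiv.ofBijective _ hg
  have hfe : ∀ e, f e = (e.1, c e) := fun _ => rfl
  have hge : ∀ e, g e = ((σ e).1, c e) := fun _ => rfl
  refine ⟨f.permMatrix ℂ, (g * f⁻¹).permMatrix ℂ, (σ * g⁻¹).permMatrix ℂ,
    ctrlPermA_permMatrix f fun e => rfl, ctrlPermB_permMatrix _ fun p => ?_,
    ctrlPermA_permMatrix _ fun p => ?_, ?_⟩
  · obtain ⟨e, rfl⟩ := f.surjective p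
    rw [Equiv.Perm.mul_apply, Equiv.Perm.inv_eq_iff_eq.2 rfl, hge, hfe]
  · obtain ⟨e, rfl⟩ := g.surjective p
    rw [Equiv.Perm.mul_apply, Equiv.Perm.inv_eq_iff_eq.2 rfl, hge]
  · rw [← Matrix.permMatrix_mul, ← Matrix.permMatrix_mul]
    congr 1
    group
end
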